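/- arXiv:2011.01770 — 5 statements merged into one kernel-verified Lean document; each statement's English description precedes it below -/
import Mathlib

section
/- Let n ≥ 3 and m ≥ 1 be integers of the same parity, and let V_1, …, V_m be a partition of the vertex set of the cycle C_n into m nonempty sets. Then there exist two disjoint independent sets S_1 and S_2 of C_n such that for every i ∈ {1,…,m} exactly one vertex of V_i lies outside S_1 ∪ S_2 (i.e., |V_i \ (S_1 ∪ S_2)| = 1), and such that for each j ∈ {1,2} and every i ∈ {1,…,m} it holds that 2·|S_j ∩ V_i| ≥ |V_i| − 2. -/
/-- A subset of the vertex set `ZMod n` of the cycle `C_n` is independent if it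
contains no two cyclically consecutive elements. -/
def CycleIndepSet (n : ℕ) (S : Finset (ZMod n)) : Prop :=
  ∀ v ∈ S, v + 1 ∉ S

section OctahedralTucker

open Finset Function

variable {ι : Type*} [Fintype ι] [DecidableEq ι]

/-- The support of a sign vector. -/
def signSupport (x : ι → SignType) : Finset ι := {i | x i ≠ 0}

/-- The number, modulo 2, of saturated chains of sign vectors of length `j` that end in `x` and
whose values under `t` change in every step. -/
def altChainCount (t : (ι → SignType) → ZMod 2) : ℕ → (ι → SignType) → ZMod 2
  | 0, _ => 1
  | j + 1, x => ∑ i ∈ signSupport x,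
      altChainCount t j (update x i 0) * (t (update x i 0) + t x)

omit [DecidableEq ι] in
lemma mem_signSupport {x : ι → SignType} {i : ι} : i ∈ signSupport x ↔ x i ≠ 0 := by
  simp [signSupport]

omit [DecidableEq ι] in
lemma signSupport_neg (x : ι → SignType) : signSupport (-x) = signSupport x := by
  ext i; simp [mem_signSupport]

lemma signSupport_update_zero (x : ι → SignType) (i : ι) :
    signSupport (update x i 0) = (signSupport x).erase i := by
  ext j
  by_cases h : j = i
  · subst h; simp [mem_signSupport]
  · simp [mem_signSupport, h]

omit [Fintype ι] in
lemma neg_update_zero (x : ι → SignType) (i : ι) : update (-x) i 0 = -update x i 0 := by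
  ext j
  by_cases h : j = i
  · subst h; simp
  · simp [h]

/-- Every interval of height two in the face poset has exactly two middle elements. -/
lemma sum_update_update_eq_zero (x : ι → SignType) (F : (ι → SignType) → ZMod 2) :
    ∑ i ∈ signSupport x, ∑ j ∈ signSupport (update x i 0),
      F (update (update x i 0) j 0) = 0 := by
  simp only [signSupport_update_zero]
  rw [Finset.sum_sigma']
  refine Finset.sum_involution (fun p _ => ⟨p.2, p.1⟩) ?_ ?_ ?_ ?_
  · rintro ⟨i, j⟩ h
    simp only [mem_sigma, mem_erase] at h
    rw [update_comm h.2.1]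
    exact CharTwo.add_self_eq_zero _
  · rintro ⟨i, j⟩ h _ h'
    simp only [mem_sigma, mem_erase] at h
    exact h.2.1 (congrArg Sigma.fst h')
  · rintro ⟨i, j⟩ h
    simp only [mem_sigma, mem_erase] at h ⊢
    exact ⟨h.2.2, Ne.symm h.2.1, h.1⟩
  · rintro ⟨i, j⟩ h
    rfl

lemma altChainCount_add_neg (t : (ι → SignType) → ZMod 2)
    (ht : ∀ x, x ≠ 0 → t (-x) = t x + 1) (j : ℕ) (x : ι → SignType)
    (hx : #(signSupport x) = j + 1) :
    altChainCount t (j + 1) x + altChainCount t (j + 1) (-x) =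
      ∑ i ∈ signSupport x, altChainCount t j (update x i 0) := by
  have hx0 : x ≠ 0 := by
    rintro rfl
    simp [signSupport] at hx
  induction j generalizing x with
  | zero =>
    obtain ⟨a, ha⟩ := card_eq_one.1 hx
    have h0 : update x a 0 = 0 := by
      ext k
      have := signSupport_update_zero x a
      rw [ha] at this
      have hk : k ∉ signSupport (update x a 0) := by simp [this]
      simpa [mem_signSupport] using hk
    simp only [altChainCount, signSupport_neg, ha, sum_singleton, neg_update_zero, h0, neg_zero,
      ht x hx0]
    generalize t 0 = a
    generalize t x = b
    revert a b
    decide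
  | succ j ih =>
    have key : ∀ i ∈ signSupport x,
        altChainCount t (j + 1) (update x i 0) * (t (update x i 0) + t x) +
        altChainCount t (j + 1) (-update x i 0) * (t (-update x i 0) + t (-x)) =
        altChainCount t (j + 1) (update x i 0) +
        ∑ k ∈ signSupport (update x i 0), altChainCount t j (update (update x i 0) k 0) *
          (t (update (update x i 0) k 0) + t x) := by
      intro i hi
      have hc : #(signSupport (update x i 0)) = j + 1 := by
        rw [signSupport_update_zero, card_erase_of_mem hi, hx]; rfl
      have hne : update x i 0 ≠ 0 := by
        intro h
        rw [h] at hc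
        simp [signSupport] at hc
      have h1 := ih _ hc hne
      rw [ht x hx0, ht _ hne]
      have h2 : ∀ a b : ZMod 2, a + 1 + (b + 1) = a + b := by decide
      rw [h2, ← add_mul, h1, altChainCount, sum_mul, ← sum_add_distrib]
      refine sum_congr rfl fun k _ => ?_
      generalize altChainCount t j _ = p
      generalize t (update (update x i 0) k 0) = q
      generalize t (update x i 0) = r
      generalize t x = s
      revert p q r s
      decide
    rw [altChainCount, altChainCount, signSupport_neg, ← sum_add_distrib]
    simp only [neg_update_zero]
    rw [sum_congr rfl key, sum_add_distrib,
      sum_update_update_eq_zero x (fun z => altChainCount t j z * (t z + t x)), add_zero]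

lemma sum_signSupport_insert {a : ι} {S : Finset ι} (ha : a ∉ S)
    (F : (ι → SignType) → ZMod 2) :
    ∑ x with signSupport x = insert a S, F x =
      ∑ x with signSupport x = S, (F (update x a 1) + F (update x a (-1))) := by
  have hsupp : ∀ x : ι → SignType, signSupport x = S → ∀ s : SignType, s ≠ 0 →
      signSupport (update x a s) = insert a S := by
    rintro x rfl s hs
    ext j
    by_cases h : j = a
    · subst h; simp [mem_signSupport, hs]
    · simp [mem_signSupport, h]
  have hback : ∀ x : ι → SignType, signSupport x = insert a S →
      signSupport (update x a 0) = S := by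
    intro x hx
    rw [signSupport_update_zero, hx, erase_insert ha]
  have hza : ∀ x : ι → SignType, signSupport x = S → x a = 0 := by
    rintro x rfl
    simpa [mem_signSupport] using ha
  have hpart : ∀ s : SignType, s ≠ 0 →
      ∑ x with signSupport x = insert a S ∧ x a = s, F x =
        ∑ x with signSupport x = S, F (update x a s) := by
    intro s hs
    refine sum_nbij' (fun x => update x a 0) (fun x => update x a s) ?_ ?_ ?_ ?_ ?_
    · intro x hx
      simp only [mem_filter, mem_univ, true_and] at hx ⊢
      exact hback x hx.1
    · intro x hx
      simp only [mem_filter, mem_univ, true_and] at hx ⊢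
      exact ⟨hsupp x hx s hs, by simp⟩
    · intro x hx
      simp only [mem_filter, mem_univ, true_and] at hx
      simp [← hx.2]
    · intro x hx
      simp only [mem_filter, mem_univ, true_and] at hx
      simp [← hza x hx]
    · intro x hx
      simp only [mem_filter, mem_univ, true_and] at hx
      simp [← hx.2]
  rw [sum_add_distrib, ← hpart 1 (by decide), ← hpart (-1) (by decide), ← sum_union]
  · refine sum_congr ?_ fun _ _ => rfl
    ext x
    simp only [mem_filter, mem_univ, true_and, mem_union, ← and_or_left]
    refine ⟨fun h => ⟨h, ?_⟩, fun h => h.1⟩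
    have : x a ≠ 0 := mem_signSupport.1 (h ▸ mem_insert_self a S)
    revert this
    generalize x a = s
    revert s
    decide
  · rw [disjoint_left]
    intro x hx hx'
    simp only [mem_filter, mem_univ, true_and] at hx hx'
    exact absurd (hx.2.symm.trans hx'.2) (by decide)

lemma sum_signSupport_neg (S : Finset ι) (F : (ι → SignType) → ZMod 2) :
    ∑ x with signSupport x = S, F (-x) = ∑ x with signSupport x = S, F x := by
  refine sum_nbij' (fun x => -x) (fun x => -x) ?_ ?_ ?_ ?_ ?_ <;> simp [signSupport_neg]

lemma sum_altChainCount (t : (ι → SignType) → ZMod 2)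
    (ht : ∀ x, x ≠ 0 → t (-x) = t x + 1) (S : Finset ι) :
    ∑ x with signSupport x = S, altChainCount t #S x = 1 := by
  induction S using Finset.induction_on with
  | empty =>
    have : ({x | signSupport x = ∅} : Finset (ι → SignType)) = {0} := by
      ext x
      simp [signSupport, filter_eq_empty_iff, funext_iff]
    simp [this, altChainCount]
  | insert a S ha ih =>
    rw [sum_signSupport_insert ha, sum_add_distrib,
      ← sum_signSupport_neg S (fun x => altChainCount t _ (update x a (-1))), ← sum_add_distrib,
      card_insert_of_notMem ha, ← ih]
    have hza : ∀ x : ι → SignType, signSupport x = S → x a = 0 := by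
      rintro x rfl
      simpa [mem_signSupport] using ha
    have key : ∀ x ∈ ({x | signSupport x = S} : Finset (ι → SignType)),
        altChainCount t (#S + 1) (update x a 1) + altChainCount t (#S + 1) (update (-x) a (-1)) =
        altChainCount t #S x + ∑ i ∈ S, altChainCount t #S (update (update x a 1) i 0) := by
      intro x hx
      simp only [mem_filter, mem_univ, true_and] at hx
      have hs : signSupport (update x a 1) = insert a S := by
        subst hx
        ext j
        by_cases h : j = a
        · subst h; simp [mem_signSupport]
        · simp [mem_signSupport, h]
      have hn : update (-x) a (-1) = -update x a 1 := by
        ext j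
        by_cases h : j = a
        · subst h; simp
        · simp [h]
      rw [hn, altChainCount_add_neg t ht _ _ (by rw [hs, card_insert_of_notMem ha]), hs,
        sum_insert ha]
      simp [← hza x hx]
    rw [sum_congr rfl key, sum_add_distrib, sum_comm, add_eq_left]
    refine sum_eq_zero fun i hi => ?_
    have hia : i ≠ a := fun h => ha (h ▸ hi)
    refine sum_involution (fun x _ => update x i (-x i)) ?_ ?_ ?_ ?_
    · intro x _
      rw [update_comm (β := fun _ => SignType) hia (-x i) 1 x, update_idem]
      exact CharTwo.add_self_eq_zero _
    · intro x hx _ h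
      simp only [mem_filter, mem_univ, true_and] at hx
      have h1 : x i ≠ 0 := mem_signSupport.1 (hx ▸ hi)
      have h2 := congrFun h i
      simp only [update_self] at h2
      revert h1 h2
      generalize x i = s
      revert s
      decide
    · intro x hx
      simp only [mem_filter, mem_univ, true_and] at hx ⊢
      rw [← hx]
      ext j
      by_cases h : j = i
      · subst h; simp [mem_signSupport]
      · simp [mem_signSupport, h]
    · intro x _
      simp

/-- A poset version of the octahedral Tucker lemma: an antipodal monotone map from the face poset
of the cross-polytope to the poset with two elements on each level needs many levels. -/
theorem exists_card_le_level (t : (ι → SignType) → ZMod 2) (level : (ι → SignType) → ℕ)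
    (ht : ∀ x, x ≠ 0 → t (-x) = t x + 1)
    (hmono : ∀ x i, level (update x i 0) < level x ∨
      level (update x i 0) = level x ∧ t (update x i 0) = t x) :
    ∃ x, Fintype.card ι ≤ level x := by
  have hlevel : ∀ j x, altChainCount t j x ≠ 0 → j ≤ level x := by
    intro j
    induction j with
    | zero => intro x _; exact Nat.zero_le _
    | succ j ih =>
      intro x hx
      obtain ⟨i, -, hi⟩ := exists_ne_zero_of_sum_ne_zero hx
      have h1 := ih _ (left_ne_zero_of_mul hi)
      rcases hmono x i with h | ⟨-, h⟩
      · omega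
      · rw [h, CharTwo.add_self_eq_zero, mul_zero] at hi
        exact absurd rfl hi
  have hsum := sum_altChainCount t ht univ
  obtain ⟨x, -, hx⟩ := exists_ne_zero_of_sum_ne_zero (hsum.trans_ne one_ne_zero)
  exact ⟨x, hlevel _ x hx⟩

/-- The octahedral Tucker lemma for a labelling which uses the labels `1, …, m` on the sign vectors
that are bad for one of them, and continues with the levels of `c` on all others. -/
theorem exists_not_bad_card_le (m : ℕ) (bad : ℕ → (ι → SignType) → Prop)
    (τ : ℕ → (ι → SignType) → ZMod 2) (c : (ι → SignType) → ℕ) (s : (ι → SignType) → ZMod 2)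
    (hbad_zero : ∀ k, ¬ bad k 0)
    (hbad_mono : ∀ k x i, bad k (update x i 0) → bad k x ∧ τ k (update x i 0) = τ k x)
    (hbad_neg : ∀ k x, bad k x → bad k (-x) ∧ τ k (-x) = τ k x + 1)
    (hs_neg : ∀ x, x ≠ 0 → c (-x) = c x ∧ s (-x) = s x + 1)
    (hc_mono : ∀ x i, c (update x i 0) < c x ∨
      c (update x i 0) = c x ∧ s (update x i 0) = s x) :
    ∃ x, (∀ k, 1 ≤ k → k ≤ m → ¬ bad k x) ∧ Fintype.card ι ≤ m + c x := by
  classical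
  by_contra! hcon
  set M : (ι → SignType) → ℕ := fun x => Nat.findGreatest (fun k => bad k x) m with hM
  have hMle : ∀ x, M x ≤ m := fun x => Nat.findGreatest_le m
  have hMbad : ∀ x, M x ≠ 0 → bad (M x) x := fun x hx =>
    Nat.findGreatest_of_ne_zero (P := fun k => bad k x) rfl hx
  have hMzero : ∀ x, M x = 0 → m + c x < Fintype.card ι := fun x hx =>
    hcon x fun k hk hkm => Nat.findGreatest_eq_zero_iff.1 hx hk hkm
  have hn := hcon 0 fun k _ _ => hbad_zero k
  have hM_neg : ∀ x, M (-x) = M x := by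
    intro x
    have hiff : ∀ k, bad k (-x) ↔ bad k x := fun k =>
      ⟨fun h => by simpa using (hbad_neg k _ h).1, fun h => (hbad_neg k _ h).1⟩
    simp only [hM, hiff]
  have hM_mono : ∀ x i, M (update x i 0) ≤ M x := fun x i =>
    Nat.findGreatest_mono (fun k h => (hbad_mono k x i h).1) le_rfl
  have ht : ∀ x, x ≠ 0 → (if M (-x) = 0 then s (-x) else τ (M (-x)) (-x)) =
      (if M x = 0 then s x else τ (M x) x) + 1 := by
    intro x hx
    rw [hM_neg]
    split_ifs with h
    · exact (hs_neg x hx).2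
    · exact (hbad_neg _ _ (hMbad x h)).2
  obtain ⟨x, hx⟩ := exists_card_le_level (fun x => if M x = 0 then s x else τ (M x) x)
    (fun x => if M x = 0 then c x else Fintype.card ι - m - 1 + M x) ht fun x i => by
      have h1 := hM_mono x i
      have h2 := hMzero (update x i 0)
      by_cases hx : M x = 0
      · have hy : M (update x i 0) = 0 := by omega
        simpa only [hx, hy, if_true] using hc_mono x i
      by_cases hy : M (update x i 0) = 0
      · have := h2 hy
        simp only [hx, hy, if_true, if_false]
        left
        omega
      simp only [hx, hy, if_false]
      rcases h1.lt_or_eq with h | h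
      · left
        omega
      · right
        have h3 := (hbad_mono _ x i (hMbad _ hy)).2
        exact ⟨by rw [h], by rwa [h] at h3 ⊢⟩
  have h1 := hMle x
  have h2 := hMzero x
  split_ifs at hx with h
  · have := h2 h
    omega
  · omega

end OctahedralTucker

section Alternation

/-- The last nonzero sign among the first `k` terms, or `0` if there is none. -/
def lastSign (u : ℕ → SignType) : ℕ → SignType
  | 0 => 0
  | k + 1 => if u k = 0 then lastSign u k else u k

/-- The number of maximal blocks of equal signs among the nonzero ones of the first `k` terms. -/
def blockCount (u : ℕ → SignType) : ℕ → ℕ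
  | 0 => 0
  | k + 1 => blockCount u k + if u k = 0 ∨ u k = lastSign u k then 0 else 1

lemma blockCount_mono {u w : ℕ → SignType} (h : ∀ k, w k = 0 ∨ w k = u k) (k : ℕ) :
    blockCount w k < blockCount u k ∨
      blockCount w k = blockCount u k ∧ lastSign w k = lastSign u k := by
  induction k with
  | zero => exact Or.inr ⟨rfl, rfl⟩
  | succ k ih =>
    have := h k
    simp only [blockCount, lastSign]
    grind

lemma lastSign_neg (u : ℕ → SignType) (k : ℕ) : lastSign (fun j => -u j) k = -lastSign u k := by
  induction k with
  | zero => rfl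
  | succ k ih =>
    simp only [lastSign, ih]
    split_ifs <;> simp_all

lemma blockCount_neg (u : ℕ → SignType) (k : ℕ) :
    blockCount (fun j => -u j) k = blockCount u k := by
  induction k with
  | zero => rfl
  | succ k ih =>
    have h : ∀ a b : SignType, (-a = 0 ∨ -a = -b) ↔ (a = 0 ∨ a = b) := by decide
    simp only [blockCount, ih, lastSign_neg, h]

lemma lastSign_ne_zero {u : ℕ → SignType} {j k : ℕ} (hj : j < k) (hu : u j ≠ 0) :
    lastSign u k ≠ 0 := by
  induction k with
  | zero => omega
  | succ k ih =>
    simp only [lastSign]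
    rcases Nat.lt_succ_iff_lt_or_eq.1 hj with h | rfl
    · have := ih h
      split_ifs <;> assumption
    · simp [hu]

lemma blockCount_eq_card (u : ℕ → SignType) (k : ℕ) :
    blockCount u k = ((Finset.range k).filter fun j => u j ≠ 0 ∧ u j ≠ lastSign u j).card := by
  induction k with
  | zero => rfl
  | succ k ih =>
    rw [Finset.range_add_one, Finset.filter_insert, blockCount, ih]
    split_ifs with h1 h2 h2
    · tauto
    · rfl
    · rw [Finset.card_insert_of_notMem (by simp)]
    · tauto

/-- The parity of the number of blocks relates the first sign to the last one. -/
lemma lastSign_succ_of_ne_zero {u : ℕ → SignType} (h0 : u 0 ≠ 0) (k : ℕ) :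
    lastSign u (k + 1) = if Even (blockCount u (k + 1)) then -u 0 else u 0 := by
  induction k with
  | zero => simp [lastSign, blockCount, h0]
  | succ k ih =>
    rw [lastSign, blockCount]
    by_cases h1 : u (k + 1) = 0
    · simpa [h1] using ih
    by_cases h2 : u (k + 1) = lastSign u (k + 1)
    · simpa [h1, h2] using ih
    · have h3 : ∀ a b c : SignType, a ≠ 0 → b ≠ 0 → a ≠ b →
          (b = -c → a = c) ∧ (b = c → a = -c) := by decide
      simp only [h1, h2, or_self, if_false, Nat.even_add_one]
      have h4 := h3 _ _ (u 0) h1 (lastSign_ne_zero (Nat.succ_pos k) h0) h2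
      split_ifs at ih ⊢
      · tauto
      · tauto

end Alternation


section SignMajority

open Finset Function

variable {ι : Type*} [DecidableEq ι]

/-- The number of elements of `A` at which the sign vector `x` takes the value `s`. -/
def signCount (s : SignType) (A : Finset ι) (x : ι → SignType) : ℕ := #{v ∈ A | x v = s}

/-- One of the two signs of `x` is taken by more than half of `A`, or both are taken by exactly
half of `A`. -/
def IsSignHeavy (A : Finset ι) (x : ι → SignType) : Prop :=
  #A < 2 * signCount 1 A x ∨ #A < 2 * signCount (-1) A x ∨
    #A ≤ signCount 1 A x + signCount (-1) A x

/-- The sign taken by `x` on more than half of `A` (`1` for positive and `0` for negative), with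
ties decided by the element `r`. -/
def majoritySign (A : Finset ι) (r : ι) (x : ι → SignType) : ZMod 2 :=
  if #A < 2 * signCount 1 A x then 1
  else if #A < 2 * signCount (-1) A x then 0
  else if x r = 1 then 1 else 0

lemma signCount_update_zero_le {s : SignType} (hs : s ≠ 0) (A : Finset ι) (x : ι → SignType)
    (i : ι) : signCount s A (update x i 0) ≤ signCount s A x := by
  refine card_le_card fun v hv => ?_
  rw [mem_filter] at hv ⊢
  by_cases h : v = i
  · subst h
    simp [hs.symm] at hv
  · simpa [h] using hv

omit [DecidableEq ι] in
lemma signCount_neg (s : SignType) (A : Finset ι) (x : ι → SignType) :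
    signCount s A (-x) = signCount (-s) A x := by
  simp only [signCount, Pi.neg_apply, neg_eq_iff_eq_neg]

omit [DecidableEq ι] in
lemma signCount_add_signCount (A : Finset ι) (x : ι → SignType) :
    signCount 1 A x + signCount (-1) A x = #{v ∈ A | x v ≠ 0} := by
  classical
  rw [signCount, signCount, ← card_union_of_disjoint]
  · congr 1
    ext v
    simp only [mem_union, mem_filter, ← and_or_left]
    generalize x v = s
    revert s
    have : ∀ s : SignType, s = 1 ∨ s = -1 ↔ s ≠ 0 := by decide
    simp [this]
  · rw [disjoint_left]
    intro v h h'
    rw [mem_filter] at h h'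
    exact absurd (h.2.symm.trans h'.2) (by decide)

omit [DecidableEq ι] in
lemma signCount_add_signCount_le (A : Finset ι) (x : ι → SignType) :
    signCount 1 A x + signCount (-1) A x ≤ #A := by
  rw [signCount_add_signCount]
  exact card_filter_le _ _

omit [DecidableEq ι] in
lemma ne_zero_of_card_le_signCount {A : Finset ι} {x : ι → SignType}
    (h : #A ≤ signCount 1 A x + signCount (-1) A x) {v : ι} (hv : v ∈ A) : x v ≠ 0 := by
  rw [signCount_add_signCount] at h
  exact filter_eq_self.1 (eq_of_subset_of_card_le (filter_subset (fun v => x v ≠ 0) A) h) v hv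

omit [DecidableEq ι] in
lemma not_isSignHeavy_zero {A : Finset ι} (hA : A.Nonempty) : ¬ IsSignHeavy A 0 := by
  have h1 : signCount 1 A 0 = 0 := by simp [signCount]
  have h2 : signCount (-1) A 0 = 0 := by simp [signCount]
  have := hA.card_pos
  rw [IsSignHeavy, h1, h2]
  omega

lemma IsSignHeavy.of_update_zero {A : Finset ι} {r : ι} (hr : r ∈ A) {x : ι → SignType} {i : ι}
    (h : IsSignHeavy A (update x i 0)) :
    IsSignHeavy A x ∧ majoritySign A r (update x i 0) = majoritySign A r x := by
  have h1 := signCount_update_zero_le (s := 1) (by decide) A x i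
  have h2 := signCount_update_zero_le (s := -1) (by decide) A x i
  have h3 := signCount_add_signCount_le A x
  have h4 : #A ≤ signCount 1 A (update x i 0) + signCount (-1) A (update x i 0) →
      update x i 0 r = x r := by
    intro h
    have := ne_zero_of_card_le_signCount h hr
    by_cases hri : r = i
    · subst hri
      simp at this
    · simp [hri]
  unfold IsSignHeavy majoritySign at *
  refine ⟨by omega, ?_⟩
  split_ifs <;> first | rfl | omega | grind

omit [DecidableEq ι] in
lemma IsSignHeavy.neg {A : Finset ι} {r : ι} (hr : r ∈ A) {x : ι → SignType}
    (h : IsSignHeavy A x) :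
    IsSignHeavy A (-x) ∧ majoritySign A r (-x) = majoritySign A r x + 1 := by
  have h3 := signCount_add_signCount_le A x
  have h4 : #A ≤ signCount 1 A x + signCount (-1) A x → (-x r = 1 ↔ ¬ x r = 1) := by
    intro h
    have := ne_zero_of_card_le_signCount h hr
    revert this
    generalize x r = s
    revert s
    decide
  unfold IsSignHeavy majoritySign at *
  simp only [signCount_neg, neg_neg, Pi.neg_apply]
  refine ⟨by omega, ?_⟩
  split_ifs <;> first | rfl | omega | grind

end SignMajority

section FairSplitting

open Finset Function

/-- The vertices of the cycle at which a new block of equal signs of `x` starts. -/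
def blockStarts {n : ℕ} [NeZero n] (x : ZMod n → SignType) : Finset (ZMod n) :=
  {v | x v ≠ 0 ∧ x v ≠ lastSign (fun k => x k) v.val}

lemma card_blockStarts {n : ℕ} [NeZero n] (x : ZMod n → SignType) :
    #(blockStarts x) = blockCount (fun k => x k) n := by
  rw [blockCount_eq_card]
  refine card_nbij' (fun v => v.val) (fun k => (k : ZMod n)) ?_ ?_ ?_ ?_
  · intro v hv
    simpa [blockStarts, ZMod.val_lt] using hv
  · intro k hk
    simp only [coe_filter, mem_range, Set.mem_ofPred_eq] at hk
    simpa [blockStarts, ZMod.val_natCast_of_lt hk.1] using hk.2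
  · intro v _
    simp
  · intro k hk
    simp only [coe_filter, mem_range, Set.mem_ofPred_eq] at hk
    exact ZMod.val_natCast_of_lt hk.1

/-- If the number of blocks is even, then signs alternate cyclically on the block starts. -/
lemma sign_add_one_ne_of_mem_blockStarts {n : ℕ} [NeZero n] {x : ZMod n → SignType}
    (heven : Even #(blockStarts x)) {v : ZMod n} (hv : v ∈ blockStarts x)
    (hv' : v + 1 ∈ blockStarts x) : x (v + 1) ≠ x v := by
  rw [card_blockStarts] at heven
  simp only [blockStarts, mem_filter, mem_univ, true_and] at hv hv'
  have hlt := ZMod.val_lt v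
  have hcast : v + 1 = ((v.val + 1 : ℕ) : ZMod n) := by simp
  have hlast : lastSign (fun k => x k) (v.val + 1) = x v := by
    simp [lastSign, hv.1]
  rcases Nat.lt_or_eq_of_le (Nat.succ_le_of_lt hlt) with h | h
  · have hval : (v + 1).val = v.val + 1 := by
      rw [hcast, ZMod.val_natCast_of_lt h]
    rw [hval, hlast] at hv'
    exact hv'.2
  · have h0 : v + 1 = 0 := by
      rw [hcast, show v.val + 1 = n from h, ZMod.natCast_self]
    rw [h0] at hv' ⊢
    have h1 := lastSign_succ_of_ne_zero (u := fun k => x k) (by simpa using hv'.1) (ZMod.val v)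
    rw [hlast, show v.val + 1 = n from h, if_pos heven] at h1
    simp only [Nat.cast_zero] at h1
    rw [h1]
    have := hv'.1
    revert this
    generalize x 0 = s
    revert s
    decide

lemma sum_card_inter_eq_card {ι κ : Type*} [Fintype ι] [DecidableEq κ] {V : ι → Finset κ}
    (hdisj : ∀ i j, i ≠ j → Disjoint (V i) (V j)) (hcover : ∀ v, ∃ i, v ∈ V i) (T : Finset κ) :
    ∑ i, #(T ∩ V i) = #T := by
  rw [← card_biUnion fun i _ j _ hij => (hdisj i j hij).mono inter_subset_right inter_subset_right]
  congr 1
  ext v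
  simpa using fun _ => hcover v

/-- A sign vector with many blocks that is not heavy on any class exists. -/
lemma exists_not_isSignHeavy {n m : ℕ} [NeZero n] [NeZero m] (V : Fin m → Finset (ZMod n))
    (hne : ∀ i, (V i).Nonempty) :
    ∃ x : ZMod n → SignType, (∀ i, ¬ IsSignHeavy (V i) x) ∧ n ≤ m + #(blockStarts x) := by
  choose r hr using hne
  have hs_neg : ∀ x : ZMod n → SignType, x ≠ 0 →
      blockCount (fun k => (-x) k) n = blockCount (fun k => x k) n ∧
      (if lastSign (fun k => (-x) k) n = 1 then 1 else 0 : ZMod 2) =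
        (if lastSign (fun k => x k) n = 1 then 1 else 0) + 1 := by
    intro x hx
    refine ⟨blockCount_neg _ n, ?_⟩
    obtain ⟨v, hv⟩ := Function.ne_iff.1 hx
    have h := lastSign_ne_zero (u := fun k => x k) (ZMod.val_lt v) (by simpa using hv)
    simp only [Pi.neg_apply, lastSign_neg]
    revert h
    generalize lastSign _ n = s
    revert s
    decide
  obtain ⟨x, hx, hcard⟩ := exists_not_bad_card_le m
    (fun k => IsSignHeavy (V (Fin.ofNat m (k - 1))))
    (fun k => majoritySign (V (Fin.ofNat m (k - 1))) (r (Fin.ofNat m (k - 1))))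
    (fun x => blockCount (fun k => x k) n)
    (fun x => if lastSign (fun k => x k) n = 1 then 1 else 0)
    (fun k => not_isSignHeavy_zero ⟨_, hr _⟩)
    (fun k x i h => h.of_update_zero (hr _))
    (fun k x h => h.neg (hr _)) hs_neg fun x i => by
      have h := blockCount_mono (u := fun k => x k) (w := fun k => update x i 0 k) (fun k => by
        by_cases h : (k : ZMod n) = i <;> simp [h]) n
      exact h.imp_right fun h => ⟨h.1, by rw [h.2]⟩
  refine ⟨x, fun i => ?_, by rwa [ZMod.card, ← card_blockStarts] at hcard⟩
  simpa using hx (i + 1) (by omega) (by omega)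

end FairSplitting

theorem fair_splitting_of_cycle (n m : ℕ) (hn : 3 ≤ n) (hm : 1 ≤ m)
    (hpar : n % 2 = m % 2)
    (V : Fin m → Finset (ZMod n))
    (hdisj : ∀ i j, i ≠ j → Disjoint (V i) (V j))
    (hne : ∀ i, (V i).Nonempty)
    (hcover : ∀ v : ZMod n, ∃ i, v ∈ V i) :
    ∃ S₁ S₂ : Finset (ZMod n),
      Disjoint S₁ S₂ ∧ CycleIndepSet n S₁ ∧ CycleIndepSet n S₂ ∧
      (∀ i, (V i \ (S₁ ∪ S₂)).card = 1) ∧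
      (∀ i, (V i).card ≤ 2 * (S₁ ∩ V i).card + 2) ∧
      (∀ i, (V i).card ≤ 2 * (S₂ ∩ V i).card + 2) := by
  have : NeZero n := ⟨by omega⟩
  have : NeZero m := ⟨by omega⟩
  obtain ⟨x, hx, hcard⟩ := exists_not_isSignHeavy V hne
  set T := blockStarts x
  let S : SignType → Finset (ZMod n) := fun s => T.filter fun v => x v = s
  have hdisjS : Disjoint (S 1) (S (-1)) := by
    rw [Finset.disjoint_left]
    intro v h h'
    exact absurd ((Finset.mem_filter.1 h).2.symm.trans (Finset.mem_filter.1 h').2) (by decide)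
  have hunion : S 1 ∪ S (-1) = T := by
    ext v
    simp only [S, Finset.mem_union, Finset.mem_filter, ← and_or_left, and_iff_left_iff_imp]
    intro hv
    have h : x v ≠ 0 := (Finset.mem_filter.1 hv).2.1
    revert h
    generalize x v = s
    revert s
    decide
  have hle : ∀ s i, (S s ∩ V i).card ≤ signCount s (V i) x := by
    intro s i
    refine Finset.card_le_card fun v hv => ?_
    simp only [S, Finset.mem_inter, Finset.mem_filter] at hv ⊢
    exact ⟨hv.2, hv.1.2⟩
  have hsplit : ∀ i, (T ∩ V i).card = (S 1 ∩ V i).card + (S (-1) ∩ V i).card := by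
    intro i
    rw [← hunion, Finset.union_inter_distrib_right, Finset.card_union_of_disjoint
      (hdisjS.mono Finset.inter_subset_left Finset.inter_subset_left)]
  have hlt : ∀ i, (T ∩ V i).card + 1 ≤ (V i).card := by
    intro i
    have h := hx i
    have h1 := hle 1 i
    have h2 := hle (-1) i
    rw [IsSignHeavy] at h
    rw [hsplit]
    omega
  have hsumT : ∑ i, ((T ∩ V i).card + 1) = T.card + m := by
    simp [Finset.sum_add_distrib, sum_card_inter_eq_card hdisj hcover T]
  have hsumV : ∑ i, (V i).card = n := by
    simpa using sum_card_inter_eq_card hdisj hcover Finset.univ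
  have hsum_le : ∑ i, ((T ∩ V i).card + 1) ≤ ∑ i, (V i).card :=
    Finset.sum_le_sum fun i _ => hlt i
  have heq : ∀ i, (T ∩ V i).card + 1 = (V i).card := fun i =>
    (Finset.sum_eq_sum_iff_of_le fun i _ => hlt i).1 (by omega) i (Finset.mem_univ i)
  have heven : Even T.card := by
    rw [Nat.even_iff]
    omega
  have hindep : ∀ s, CycleIndepSet n (S s) := by
    intro s v hv hv'
    rw [Finset.mem_filter] at hv hv'
    exact sign_add_one_ne_of_mem_blockStarts heven hv.1 hv'.1 (hv'.2.trans hv.2.symm)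
  refine ⟨S 1, S (-1), hdisjS, hindep 1, hindep (-1), ?_, ?_, ?_⟩
  · intro i
    have h := Finset.card_sdiff_add_card_inter (V i) T
    rw [Finset.inter_comm] at h
    rw [hunion]
    have := heq i
    omega
  all_goals
    intro i
    have h := hx i
    have h1 := hle 1 i
    have h2 := hle (-1) i
    have h3 := heq i
    have h4 := hsplit i
    rw [IsSignHeavy] at h
    omega
end

section
/- Let n ≥ 3 and m ≥ 1 be integers and let V_1, …, V_m be a partition of the vertex set of the cycle C_n into m nonempty sets. Then there exists an independent set S of C_n such that for every i ∈ {1,…,m} it holds that 2·|S ∩ V_i| ≥ |V_i| − 2 (that is, |S ∩ V_i| ≥ |V_i|/2 − 1). -/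
/-- The mod 2 coboundary on functions of lists: sum of `f` over all deletions of one entry. -/
def delSum {α : Type*} : (List α → ZMod 2) → List α → ZMod 2
  | _, [] => 0
  | f, a :: l => f l + delSum (fun l' => f (a :: l')) l

theorem delSum_congr_sublist {α : Type*} {f g : List α → ZMod 2} {l : List α}
    (h : ∀ l', l'.Sublist l → f l' = g l') : delSum f l = delSum g l := by
  induction l generalizing f g with
  | nil => rfl
  | cons a l ih =>
    simp only [delSum]
    rw [h l (List.sublist_cons_self a l), ih fun l' hl' => h _ (hl'.cons_cons a)]

theorem delSum_perm {α : Type*} {f : List α → ZMod 2} {l l' : List α} (hl : l.Perm l')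
    (hf : ∀ k k' : List α, k.Perm k' → f k = f k') : delSum f l = delSum f l' := by
  induction hl generalizing f with
  | nil => rfl
  | cons a h ih =>
    simp only [delSum]
    rw [hf _ _ h, ih fun k k' hk => hf _ _ (hk.cons a)]
  | swap a b l =>
    have : (fun k => f (b :: a :: k)) = fun k => f (a :: b :: k) :=
      funext fun k => hf _ _ (.swap a b k)
    simp only [delSum, this]
    ring
  | trans _ _ ih₁ ih₂ => rw [ih₁ hf, ih₂ hf]

theorem delSum_map {α β : Type*} (φ : α → β) (f : List β → ZMod 2) (l : List α) :
    delSum f (l.map φ) = delSum (fun k => f (k.map φ)) l := by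
  induction l generalizing f with
  | nil => rfl
  | cons a l ih => simp [delSum, ih]

/-- The label opposite to `x`: labels `2 * j` and `2 * j + 1` stand for `-j` and `+j`. -/
def oppLabel (x : ℕ) : ℕ := if x % 2 = 0 then x + 1 else x - 1

/-- The indicator of the lists of labels whose signs alternate, starting with the sign `b`. -/
def alternates : Bool → List ℕ → ZMod 2
  | _, [] => 1
  | b, a :: l => if decide (a % 2 = 1) = b then alternates (!b) l else 0

theorem delSum_alternates (b : Bool) (l : List ℕ) :
    delSum (alternates b) l = alternates b l + alternates (!b) l := by
  induction l generalizing b with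
  | nil => simp [delSum, alternates, CharTwo.add_self_eq_zero]
  | cons a l ih =>
    have hz : ∀ l : List ℕ, delSum (fun _ => (0 : ZMod 2)) l = 0 := by
      intro l
      induction l with
      | nil => rfl
      | cons a l ih => simp [delSum, ih]
    by_cases hb : decide (a % 2 = 1) = b
    · have hb' : decide (a % 2 = 1) ≠ !b := by simp [hb]
      simp only [delSum, alternates, if_pos hb, if_neg hb', ih, Bool.not_not]
      have := CharTwo.add_self_eq_zero (alternates b l)
      linear_combination this
    · have hb' : decide (a % 2 = 1) = !b := by cases b <;> simp_all
      simp only [delSum, alternates, if_neg hb, if_pos hb', hz, Bool.not_not]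
      ring

theorem alternates_map_oppLabel (b : Bool) (l : List ℕ) :
    alternates b (l.map oppLabel) = alternates (!b) l := by
  induction l generalizing b with
  | nil => rfl
  | cons a l ih =>
    have : decide (oppLabel a % 2 = 1) = !decide (a % 2 = 1) := by
      rcases Nat.mod_two_eq_zero_or_one a with h | h <;> simp [oppLabel, h] <;> omega
    simp only [List.map_cons, alternates, ih, this]
    cases b <;> simp

/-- The indicator of the lists of labels which, once sorted, alternate starting with `true`. -/
def sortAlternates (l : List ℕ) : ZMod 2 := alternates true (l.insertionSort (· ≤ ·))

theorem sortAlternates_perm {l l' : List ℕ} (h : l.Perm l') :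
    sortAlternates l = sortAlternates l' := by
  unfold sortAlternates
  congr 1
  refine List.Perm.eq_of_pairwise' (r := (· ≤ ·)) (List.pairwise_insertionSort _ _)
    (List.pairwise_insertionSort _ _) ?_
  exact ((List.perm_insertionSort _ _).trans h).trans (List.perm_insertionSort _ _).symm

theorem delSum_sortAlternates (l : List ℕ) (h : ∀ a ∈ l, ∀ b ∈ l, b ≠ oppLabel a) :
    delSum sortAlternates l = sortAlternates l + sortAlternates (l.map oppLabel) := by
  have h1 : sortAlternates (l.map oppLabel) = alternates false (l.insertionSort (· ≤ ·)) := by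
    unfold sortAlternates
    rw [← List.map_insertionSort (r := (· ≤ ·)), alternates_map_oppLabel]
    · rfl
    · intro a ha b hb
      have h₁ := h a ha b hb
      have h₂ := h b hb a ha
      unfold oppLabel at *
      grind
  rw [h1, delSum_perm (List.perm_insertionSort (· ≤ ·) l).symm fun _ _ => sortAlternates_perm,
    delSum_congr_sublist (g := alternates true), delSum_alternates]
  · rfl
  · intro l' hl'
    unfold sortAlternates
    rw [List.Pairwise.insertionSort_eq]
    exact (List.pairwise_insertionSort _ _).sublist hl'

theorem alternates_eq_zero_of_bounded {M c : ℕ} {l : List ℕ} {b : Bool}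
    (hs : l.Pairwise (· ≤ ·)) (h : ∀ x ∈ l, ∀ y ∈ l, y ≠ oppLabel x)
    (hM : ∀ x ∈ l, x < 2 * M) (hc : ∀ x ∈ l, 2 * c ≤ x) (hl : M < c + l.length)
    (hcM : c ≤ M) :
    alternates b l = 0 := by
  induction l generalizing c b with
  | nil => simp at hl; omega
  | cons a l ih =>
    simp only [alternates]
    split_ifs with hb
    · rw [List.pairwise_cons] at hs
      simp only [List.mem_cons, forall_eq_or_imp, List.length_cons] at *
      match l with
      | [] => simp at hl; omega
      | a' :: l' =>
        by_cases hb' : decide (a' % 2 = 1) = !b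
        · apply ih hs.2 (fun x hx => (h.2 x hx).2) hM.2 (c := c + 1)
          · intro x hx
            have h1 := hs.1 a' (by simp)
            have h2 : a' ≤ x := by
              rcases List.mem_cons.1 hx with rfl | hx
              · exact le_rfl
              · exact (List.pairwise_cons.1 hs.2).1 x hx
            have h3 := h.1.2 a' (by simp)
            have h4 : a % 2 ≠ a' % 2 := by
              intro h; rw [← h, hb] at hb'; simp at hb'
            have := hc.1
            unfold oppLabel at h3
            grind
          · omega
          · omega
        · simp [alternates, hb']
    · rfl

theorem sortAlternates_eq_zero_of_bounded {M : ℕ} {l : List ℕ}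
    (h : ∀ x ∈ l, ∀ y ∈ l, y ≠ oppLabel x) (hM : ∀ x ∈ l, x < 2 * M) (hl : M < l.length) :
    sortAlternates l = 0 := by
  apply alternates_eq_zero_of_bounded (M := M) (c := 0) (List.pairwise_insertionSort _ _)
  · simpa using h
  · simpa using hM
  · simp
  · simpa using hl
  · simp

section Flags

/-- Sum of `f` over all decreasing lists `X₁ ⊃ X₂ ⊃ ⋯ ⊃ X_k` starting at `X₁ = X` in which
each set arises from the preceding one by erasing one element. -/
def flagSum {α : Type*} [DecidableEq α] : (List (Finset α) → ZMod 2) → ℕ → Finset α → ZMod 2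
  | f, 0, _ => f []
  | f, k + 1, X => ∑ p ∈ X, flagSum (fun L => f (X :: L)) k (X.erase p)

theorem flagSum_congr {α : Type*} [DecidableEq α] {f g : List (Finset α) → ZMod 2} {k : ℕ}
    {X : Finset α} (hk : X.card = k)
    (h : ∀ L : List (Finset α), L.length = k → L.Pairwise (fun A B => B ⊆ A) →
      (∀ A ∈ L, A ⊆ X ∧ A.Nonempty) → f L = g L) : flagSum f k X = flagSum g k X := by
  induction k generalizing f g X with
  | zero => exact h [] rfl .nil (by simp)
  | succ k ih =>
    refine Finset.sum_congr rfl fun p hp => ih (by simp [Finset.card_erase_of_mem hp, hk]) ?_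
    intro L hL hL' hLX
    apply h
    · simp [hL]
    · exact List.pairwise_cons.2
        ⟨fun A hA => (hLX A hA).1.trans (Finset.erase_subset _ _), hL'⟩
    · intro A hA
      rcases List.mem_cons.1 hA with rfl | hA
      · exact ⟨subset_rfl, p, hp⟩
      · exact ⟨(hLX A hA).1.trans (Finset.erase_subset _ _), (hLX A hA).2⟩

theorem flagSum_add {α : Type*} [DecidableEq α] (f g : List (Finset α) → ZMod 2) (k : ℕ)
    (X : Finset α) : flagSum (fun L => f L + g L) k X = flagSum f k X + flagSum g k X := by
  induction k generalizing f g X with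
  | zero => rfl
  | succ k ih => simp only [flagSum, ih, Finset.sum_add_distrib]

theorem flagSum_map {α β : Type*} [DecidableEq α] [DecidableEq β] (e : α ↪ β)
    (f : List (Finset β) → ZMod 2) (k : ℕ) (X : Finset α) :
    flagSum f k (X.map e) = flagSum (fun L => f (L.map (Finset.map e))) k X := by
  induction k generalizing f X with
  | zero => rfl
  | succ k ih => simp only [flagSum, Finset.sum_map, ← Finset.map_erase, ih, List.map_cons]

theorem sum_sum_erase_eq_zero {α : Type*} [DecidableEq α] (X : Finset α)
    (F : Finset α → ZMod 2) : ∑ p ∈ X, ∑ q ∈ X.erase p, F ((X.erase p).erase q) = 0 := by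
  rw [Finset.sum_sigma']
  refine Finset.sum_involution (fun x _ => ⟨x.2, x.1⟩) ?_ ?_ ?_ ?_
  · rintro ⟨p, q⟩ _
    simp only [Finset.erase_right_comm (a := p) (b := q)]
    exact CharTwo.add_self_eq_zero _
  · rintro ⟨p, q⟩ h _ h'
    simp only [Finset.mem_sigma, Finset.mem_erase, Sigma.mk.injEq] at h h'
    exact h.2.1 h'.1
  · rintro ⟨p, q⟩ h
    simp only [Finset.mem_sigma, Finset.mem_erase] at h ⊢
    exact ⟨h.2.2, h.2.1.symm, h.1⟩
  · rintro ⟨p, q⟩ _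
    rfl

theorem flagSum_delSum {α : Type*} [DecidableEq α] (f : List (Finset α) → ZMod 2) (k : ℕ)
    (X : Finset α) :
    flagSum (delSum f) (k + 1) X = ∑ p ∈ X, flagSum f k (X.erase p) := by
  induction k generalizing f X with
  | zero => simp [flagSum, delSum]
  | succ k ih =>
    rw [flagSum]
    simp only [delSum, flagSum_add, ih, Finset.sum_add_distrib]
    rw [sum_sum_erase_eq_zero X (flagSum (fun L => f (X :: L)) k), add_zero]

/-- Sum of `f` over all sign vectors with support `l`. -/
def signSum {ι : Type*} [DecidableEq ι] :
    List ι → (Finset (ι × Bool) → ZMod 2) → ZMod 2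
  | [], f => f ∅
  | c :: l, f => signSum l (fun X => f (insert (c, true) X)) +
      signSum l (fun X => f (insert (c, false) X))

/-- Sign vectors with support contained in `W`. -/
def IsSignVector {ι : Type*} (W : Set ι) (X : Finset (ι × Bool)) : Prop :=
  ∀ p ∈ X, p.1 ∈ W ∧ (p.1, !p.2) ∉ X

theorem IsSignVector.mono {ι : Type*} {W : Set ι} {X Y : Finset (ι × Bool)} (hX : IsSignVector W X)
    (h : Y ⊆ X) : IsSignVector W Y :=
  fun p hp => ⟨(hX p (h hp)).1, fun hp' => (hX p (h hp)).2 (h hp')⟩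

/-- The antipodal map on signed elements. -/
def flipSign (ι : Type*) : ι × Bool ↪ ι × Bool :=
  ⟨fun p => (p.1, !p.2), fun p q h => by
    obtain ⟨p₁, p₂⟩ := p
    obtain ⟨q₁, q₂⟩ := q
    simpa using h⟩

@[simp]
theorem flipSign_apply {ι : Type*} (c : ι) (b : Bool) : flipSign ι (c, b) = (c, !b) := rfl

theorem mem_map_flipSign {ι : Type*} {X : Finset (ι × Bool)} {c : ι} {b : Bool} :
    (c, b) ∈ X.map (flipSign ι) ↔ (c, !b) ∈ X := by
  rw [show (c, b) = flipSign ι (c, !b) by simp, Finset.mem_map']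

variable {ι : Type*} [DecidableEq ι]

theorem IsSignVector.insert {c : ι} {l : List ι} (hc : c ∉ l) {X : Finset (ι × Bool)}
    (hX : IsSignVector {x | x ∈ l} X) (b : Bool) :
    IsSignVector {x | x ∈ c :: l} (insert (c, b) X) := by
  rintro ⟨d, s⟩ hp
  have hX' : ∀ s, (c, s) ∉ X := fun s hs => hc (hX _ hs).1
  rcases Finset.mem_insert.1 hp with h | h
  · obtain ⟨rfl, rfl⟩ := Prod.mk.inj h
    simp [hX']
  · have := hX _ h
    simp only [Set.mem_ofPred_eq] at this
    refine ⟨by simp [this.1], ?_⟩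
    have : d ≠ c := fun h => hc (h ▸ this.1)
    simp_all

theorem signSum_congr {l : List ι} (hl : l.Nodup) {f g : Finset (ι × Bool) → ZMod 2}
    (h : ∀ X, IsSignVector {x | x ∈ l} X → X.card = l.length → f X = g X) :
    signSum l f = signSum l g := by
  induction l generalizing f g with
  | nil => exact h ∅ (by simp [IsSignVector]) rfl
  | cons c l ih =>
    rw [List.nodup_cons] at hl
    have key : ∀ b, signSum l (fun X => f (insert (c, b) X)) =
        signSum l (fun X => g (insert (c, b) X)) := fun b => ih hl.2 fun X hX hXl =>
      h _ (hX.insert hl.1 b) (by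
        rw [Finset.card_insert_of_notMem fun hs : (c, b) ∈ X => hl.1 (hX _ hs).1, hXl,
          List.length_cons])
    simp only [signSum, key]

theorem signSum_add (l : List ι) (f g : Finset (ι × Bool) → ZMod 2) :
    signSum l (fun X => f X + g X) = signSum l f + signSum l g := by
  induction l generalizing f g with
  | nil => rfl
  | cons c l ih => simp only [signSum, ih]; ring

theorem signSum_map_flipSign (l : List ι) (f : Finset (ι × Bool) → ZMod 2) :
    signSum l (fun X => f (X.map (flipSign ι))) = signSum l f := by
  induction l generalizing f with
  | nil => rfl
  | cons c l ih =>
    simp only [signSum, Finset.map_insert]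
    rw [ih fun X => f (insert (flipSign ι (c, true)) X),
      ih fun X => f (insert (flipSign ι (c, false)) X)]
    simp [add_comm]

theorem signSum_sum_erase {l : List ι} (hl : l.Nodup) (f : Finset (ι × Bool) → ZMod 2) :
    signSum l (fun X => ∑ p ∈ X, f (X.erase p)) = 0 := by
  induction l generalizing f with
  | nil => rfl
  | cons c l ih =>
    rw [List.nodup_cons] at hl
    have key : ∀ b, signSum l (fun X => ∑ p ∈ insert (c, b) X, f ((insert (c, b) X).erase p)) =
        signSum l f := by
      intro b
      rw [← add_zero (signSum l f), ← ih hl.2 fun X => f (insert (c, b) X), ← signSum_add]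
      refine signSum_congr hl.2 fun X hX _ => ?_
      have hc : (c, b) ∉ X := fun hs => hl.1 (hX _ hs).1
      rw [Finset.sum_insert hc, Finset.erase_insert hc]
      congr 1
      refine Finset.sum_congr rfl fun p hp => ?_
      rw [Finset.erase_insert_of_ne]
      rintro rfl
      exact hc hp
    simp only [signSum, key, CharTwo.add_self_eq_zero]

/-- The octahedral Tucker lemma. -/
theorem octahedral_tucker {W : Finset ι} {M : ℕ} (hM : M < W.card)
    (lab : Finset (ι × Bool) → ℕ)
    (hlt : ∀ X, IsSignVector (W : Set ι) X → X.Nonempty → lab X < 2 * M)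
    (hanti : ∀ X, IsSignVector (W : Set ι) X → X.Nonempty →
      lab (X.map (flipSign ι)) = oppLabel (lab X)) :
    ∃ X Y, IsSignVector (W : Set ι) Y ∧ X.Nonempty ∧ X ⊆ Y ∧
      (lab Y = oppLabel (lab X)) := by
  by_contra! hcon
  have hne : ∀ (X : Finset (ι × Bool)) (L : List (Finset (ι × Bool))),
      IsSignVector (W : Set ι) X → L.Pairwise (fun A B => B ⊆ A) →
      (∀ A ∈ L, A ⊆ X ∧ A.Nonempty) →
      ∀ x ∈ L.map lab, ∀ y ∈ L.map lab, y ≠ oppLabel x := by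
    intro X L hX hL hLX x hx y hy
    obtain ⟨A, hA, rfl⟩ := List.mem_map.1 hx
    obtain ⟨B, hB, rfl⟩ := List.mem_map.1 hy
    have hcmp : A ⊆ B ∨ B ⊆ A := by
      exact List.Pairwise.forall_of_forall_of_flip (R := fun A B => A ⊆ B ∨ B ⊆ A)
        (fun _ _ => Or.inl subset_rfl) (hL.imp Or.inr) (hL.imp Or.inl) hA hB
    rcases hcmp with h | h
    · exact hcon A B (hX.mono (hLX B hB).1) (hLX A hA).2 h
    · intro h'
      refine hcon B A (hX.mono (hLX A hA).1) (hLX B hB).2 h ?_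
      rw [h']
      unfold oppLabel
      split_ifs <;> omega
  let α : List (Finset (ι × Bool)) → ZMod 2 := fun L => sortAlternates (L.map lab)
  have step : ∀ l : List ι, l.Nodup → (∀ x ∈ l, x ∈ W) →
      signSum l (flagSum α l.length) = 1 := by
    intro l hl hlW
    induction l with
    | nil => rfl
    | cons c l ih =>
      rw [List.nodup_cons] at hl
      rw [← ih hl.2 fun x hx => hlW x (List.mem_cons_of_mem _ hx), signSum,
        ← signSum_map_flipSign l fun X => flagSum α (c :: l).length (insert (c, false) X),
        ← signSum_add, ← add_zero (signSum l (flagSum α l.length)),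
        ← signSum_sum_erase hl.2 fun X => flagSum α l.length (insert (c, true) X), ← signSum_add]
      refine signSum_congr hl.2 fun X hX hXl => ?_
      have hc : (c, true) ∉ X := fun hs => hl.1 (hX _ hs).1
      have hflip : insert (c, false) (X.map (flipSign ι)) =
          (insert (c, true) X).map (flipSign ι) := by
        simp [Finset.map_insert]
      have hsum : ∑ p ∈ insert (c, true) X, flagSum α l.length ((insert (c, true) X).erase p) =
          flagSum α l.length X +
            ∑ p ∈ X, flagSum α l.length (insert (c, true) (X.erase p)) := by
        rw [Finset.sum_insert hc, Finset.erase_insert hc]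
        congr 1
        refine Finset.sum_congr rfl fun p hp => ?_
        rw [Finset.erase_insert_of_ne]
        rintro rfl
        exact hc hp
      rw [hflip, flagSum_map, ← flagSum_add, ← hsum, ← flagSum_delSum, List.length_cons]
      have hX' : IsSignVector (W : Set ι) (insert (c, true) X) := fun p hp =>
        ⟨hlW _ ((hX.insert hl.1 true) p hp).1, ((hX.insert hl.1 true) p hp).2⟩
      refine flagSum_congr (by rw [Finset.card_insert_of_notMem hc, hXl]) ?_
      intro L _ hL hLX
      have := delSum_sortAlternates (L.map lab) (hne _ L hX' hL hLX)
      rw [delSum_map] at this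
      rw [this]
      congr 2
      simp only [α, List.map_map]
      congr 1
      refine List.map_congr_left fun A hA => ?_
      exact hanti A (hX'.mono (hLX A hA).1) (hLX A hA).2
  have h1 := step W.toList W.nodup_toList (by simp)
  have h0 : signSum W.toList (flagSum α W.toList.length) =
      signSum W.toList (fun _ => 0) := by
    refine signSum_congr W.nodup_toList fun X hX hXl => ?_
    have hX' : IsSignVector (W : Set ι) X := by simpa [IsSignVector] using hX
    have hz : ∀ k (Y : Finset (ι × Bool)), flagSum (fun _ => 0) k Y = 0 := by
      intro k
      induction k with
      | zero => intro; rfl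
      | succ k ih => intro Y; simp [flagSum, ih]
    rw [← hz W.toList.length X]
    refine flagSum_congr hXl fun L hLl hL hLX => ?_
    refine sortAlternates_eq_zero_of_bounded (M := M) (hne X L hX' hL hLX) ?_ ?_
    · intro x hx
      obtain ⟨A, hA, rfl⟩ := List.mem_map.1 hx
      exact hlt A (hX'.mono (hLX A hA).1) (hLX A hA).2
    · simpa [hLl] using hM
  have hz : ∀ l : List ι, signSum l (fun _ => 0) = 0 := by
    intro l
    induction l with
    | nil => rfl
    | cons c l ih => simp [signSum, ih]
  rw [h0, hz] at h1
  exact zero_ne_one h1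


/-- A form of the octahedral Tucker lemma in which the label of a sign vector `X` is the largest
`j` for which one of `Q X j true` and `Q X j false` holds, signed accordingly. -/
theorem card_le_of_signed_levels {W : Finset ι} {M : ℕ}
    (Q : Finset (ι × Bool) → ℕ → Bool → Prop)
    (hmono : ∀ X Y j s, X ⊆ Y → Q X j s → Q Y j s)
    (hflip : ∀ X j s, Q (X.map (flipSign ι)) j s ↔ Q X j (!s))
    (hlt : ∀ X j s, Q X j s → j < M)
    (hex : ∀ X, IsSignVector (W : Set ι) X → X.Nonempty → ∃ j s, Q X j s)
    (huniq : ∀ X j, IsSignVector (W : Set ι) X → Q X j true → Q X j false →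
      ∃ j' s, j < j' ∧ Q X j' s) : W.card ≤ M := by
  classical
  by_contra! hM
  let lev : Finset (ι × Bool) → ℕ := fun X => Nat.findGreatest (fun j => ∃ s, Q X j s) M
  have hlev : ∀ X, IsSignVector (W : Set ι) X → X.Nonempty → ∃ s, Q X (lev X) s := by
    intro X hX hX'
    obtain ⟨j, hj⟩ := hex X hX hX'
    exact Nat.findGreatest_spec (P := fun j => ∃ s, Q X j s) (hlt _ _ _ hj.choose_spec).le hj
  have hmax : ∀ X j s, Q X j s → j ≤ lev X := fun X j s h =>
    Nat.le_findGreatest (hlt _ _ _ h).le ⟨s, h⟩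
  have hnot : ∀ X, IsSignVector (W : Set ι) X → Q X (lev X) true → ¬ Q X (lev X) false := by
    intro X hX h h'
    obtain ⟨j', s, hj, hQ⟩ := huniq X _ hX h h'
    exact (hmax X j' s hQ).not_gt hj
  have hlevflip : ∀ X, lev (X.map (flipSign ι)) = lev X := by
    intro X
    simp only [lev, hflip, Bool.exists_bool, Bool.not_true, Bool.not_false, or_comm]
  let lab : Finset (ι × Bool) → ℕ := fun X =>
    2 * lev X + if Q X (lev X) true then 1 else 0
  obtain ⟨X, Y, hY, hX, hXY, h⟩ := octahedral_tucker hM lab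
    (by
      intro X hX hX'
      obtain ⟨s, hs⟩ := hlev X hX hX'
      have := hlt _ _ _ hs
      simp only [lab]
      split_ifs <;> omega)
    (by
      intro X hX hX'
      obtain ⟨s, hs⟩ := hlev X hX hX'
      have := hnot X hX
      simp only [lab, hlevflip, hflip, Bool.not_true, oppLabel]
      cases s
      · rw [if_pos hs, if_neg fun h => this h hs]
        simp
      · rw [if_pos hs, if_neg (this hs)]
        simp)
  have hXv := hY.mono hXY
  have hYne := hX.mono hXY
  obtain ⟨s, hs⟩ := hlev X hXv hX
  obtain ⟨t, ht⟩ := hlev Y hY hYne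
  have hX' := hnot X hXv
  have hY' := hnot Y hY
  have hlevel : lev X = lev Y := by
    simp only [lab, oppLabel] at h
    split_ifs at h <;> omega
  have hs' := hmono _ _ _ _ hXY hs
  rw [hlevel] at hs'
  have hXs : Q X (lev X) true ↔ Q Y (lev Y) true := by
    cases s
    · exact ⟨fun h => absurd hs (hX' h), fun h => absurd hs' (hY' h)⟩
    · exact ⟨fun _ => hs', fun _ => hs⟩
  simp only [lab, hlevel, oppLabel] at h
  simp only [hlevel] at hXs
  simp only [hXs] at h
  split_ifs at h <;> omega

end Flags

/-- The entries of the list, signed alternatingly starting with the given sign, lie in `X`. -/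
def AltIn (X : Finset (ℕ × Bool)) : Bool → List ℕ → Prop
  | _, [] => True
  | b, a :: l => (a, b) ∈ X ∧ AltIn X (!b) l

theorem AltIn.mono {X Y : Finset (ℕ × Bool)} (h : X ⊆ Y) {b : Bool} {l : List ℕ}
    (hl : AltIn X b l) : AltIn Y b l := by
  induction l generalizing b with
  | nil => trivial
  | cons a l ih => exact ⟨h hl.1, ih hl.2⟩

theorem altIn_map_flipSign {X : Finset (ℕ × Bool)} {b : Bool} {l : List ℕ} :
    AltIn (X.map (flipSign ℕ)) b l ↔ AltIn X (!b) l := by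
  induction l generalizing b with
  | nil => rfl
  | cons a l ih => exact and_congr mem_map_flipSign ih

theorem AltIn.exists_mem {X : Finset (ℕ × Bool)} {b : Bool} {l : List ℕ}
    (hl : AltIn X b l) {a : ℕ} (ha : a ∈ l) : ∃ s, (a, s) ∈ X := by
  induction l generalizing b with
  | nil => simp at ha
  | cons c l ih =>
    rcases List.mem_cons.1 ha with rfl | ha
    · exact ⟨b, hl.1⟩
    · exact ih hl.2 ha

/-- Every other entry of an alternating increasing list of even length. -/
theorem AltIn.exists_separated {X : Finset (ℕ × Bool)} {b : Bool} {k : ℕ} {l : List ℕ}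
    (hl : AltIn X b l) (hk : l.length = 2 * k) (hs : l.Pairwise (· < ·)) :
    ∃ S : Finset ℕ, S.card = k ∧ (∀ v ∈ S, (v, b) ∈ X ∧ v ∈ l) ∧
      (∀ v ∈ S, v + 1 ∉ S) ∧ ∀ v ∈ S, ∃ w ∈ l, v < w := by
  induction k generalizing l with
  | zero => exact ⟨∅, by simp⟩
  | succ k ih =>
    match l with
    | [] => simp at hk
    | [a] => simp at hk; omega
    | a :: c :: l =>
      simp only [List.pairwise_cons, List.mem_cons, forall_eq_or_imp] at hs
      obtain ⟨S, hcard, hS, hsep, hlast⟩ := ih (l := l) (by simpa using hl.2.2)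
        (by simp at hk; omega) hs.2.2
      have hgt : ∀ v ∈ S, c < v := fun v hv => hs.2.1 v (hS v hv).2
      refine ⟨insert a S, ?_, ?_, ?_, ?_⟩
      · rw [Finset.card_insert_of_notMem, hcard]
        exact fun h => absurd (hgt a h) (by omega)
      · intro v hv
        rcases Finset.mem_insert.1 hv with rfl | hv
        · exact ⟨hl.1, by simp⟩
        · exact ⟨(hS v hv).1, by simp [(hS v hv).2]⟩
      · intro v hv hv'
        rcases Finset.mem_insert.1 hv with rfl | hv
        · rcases Finset.mem_insert.1 hv' with h | h
          · omega
          · have := hgt _ h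
            omega
        · rcases Finset.mem_insert.1 hv' with h | h
          · have := hgt _ hv
            omega
          · exact hsep v hv h
      · intro v hv
        rcases Finset.mem_insert.1 hv with rfl | hv
        · exact ⟨c, by simp, hs.1.1⟩
        · obtain ⟨w, hw, hvw⟩ := hlast v hv
          exact ⟨w, by simp [hw], hvw⟩

/-- Two alternating lists of equal length with opposite initial signs give a longer one. -/
theorem AltIn.exists_longer {X : Finset (ℕ × Bool)} (hX : ∀ p ∈ X, (p.1, !p.2) ∉ X)
    {k : ℕ} {l l' : List ℕ} (hl : AltIn X true l) (hl' : AltIn X false l')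
    (hk : l.length = k + 1) (hk' : l'.length = k + 1) (hs : l.Pairwise (· < ·))
    (hs' : l'.Pairwise (· < ·)) :
    ∃ s q, q.length = k + 2 ∧ q.Pairwise (· < ·) ∧ AltIn X s q := by
  match l, l' with
  | [], _ => simp at hk
  | _, [] => simp at hk'
  | a :: l, a' :: l' =>
    rcases lt_trichotomy a a' with h | rfl | h
    · refine ⟨true, a :: a' :: l', by simpa using hk', List.pairwise_cons.2 ⟨?_, hs'⟩, hl.1, hl'⟩
      intro x hx
      rcases List.mem_cons.1 hx with rfl | hx
      · exact h
      · exact h.trans ((List.pairwise_cons.1 hs').1 x hx)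
    · exact absurd hl'.1 (hX _ hl.1)
    · refine ⟨false, a' :: a :: l, by simpa using hk, List.pairwise_cons.2 ⟨?_, hs⟩, hl'.1, hl⟩
      intro x hx
      rcases List.mem_cons.1 hx with rfl | hx
      · exact h
      · exact h.trans ((List.pairwise_cons.1 hs).1 x hx)

/-- Fair independent sets for disjoint parts of odd size in a cycle on `{0, …, n - 1}`. -/
theorem exists_fair_separated {n m : ℕ} (U : Fin m → Finset ℕ) (r : Fin m → ℕ)
    (hdisj : ∀ i j, i ≠ j → Disjoint (U i) (U j)) (hU : ∀ i, ∀ v ∈ U i, v < n)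
    (hcard : ∀ i, (U i).card = 2 * r i + 1) :
    ∃ S : Finset ℕ, (∀ v ∈ S, v + 1 < n ∧ v + 1 ∉ S) ∧ ∀ i, r i ≤ (S ∩ U i).card := by
  set k := ∑ i, r i with hk
  rcases Nat.eq_zero_or_pos k with hk0 | hkpos
  · refine ⟨∅, by simp, fun i => ?_⟩
    rw [hk, Finset.sum_eq_zero_iff] at hk0
    simp [hk0 i (Finset.mem_univ i)]
  by_contra! hcon
  set W : Finset ℕ := Finset.univ.biUnion U with hW
  have hWcard : W.card = 2 * k + m := by
    rw [hW, Finset.card_biUnion fun i _ j _ hij => hdisj i j hij]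
    simp [hcard, Finset.sum_add_distrib, ← Finset.mul_sum, hk]
  let A : Finset (ℕ × Bool) → ℕ → Bool → Prop := fun X l s =>
    ∃ q : List ℕ, q.length = l ∧ q.Pairwise (· < ·) ∧ AltIn X s q
  let B : Finset (ℕ × Bool) → Fin m → Bool → Prop := fun X i s =>
    r i + 1 ≤ {v ∈ U i | (v, s) ∈ X}.card
  have hAB : ∀ X s, IsSignVector (W : Set ℕ) X → A X (2 * k) s → ∃ i, B X i s := by
    rintro X s hX ⟨q, hqk, hq, hqX⟩
    obtain ⟨S, hSk, hS, hsep, hlast⟩ := hqX.exists_separated hqk hq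
    by_contra! hB
    have hSr : ∀ i, (S ∩ U i).card ≤ r i := by
      intro i
      refine le_trans (Finset.card_le_card ?_) (Nat.le_of_lt_succ (not_le.1 (hB i)))
      intro v hv
      rw [Finset.mem_inter] at hv
      exact Finset.mem_filter.2 ⟨hv.2, (hS v hv.1).1⟩
    have hsum : ∑ i, (S ∩ U i).card = ∑ i, r i := by
      rw [← hk, ← hSk, ← Finset.card_biUnion, ← Finset.inter_biUnion]
      · congr 1
        exact Finset.inter_eq_left.2 fun v hv => (hX _ (hS v hv).1).1
      · exact fun i _ j _ hij =>
          (hdisj i j hij).mono Finset.inter_subset_right Finset.inter_subset_right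
    obtain ⟨i, hi⟩ := hcon S fun v hv => by
      obtain ⟨w, hw, hvw⟩ := hlast v hv
      obtain ⟨t, ht⟩ := hqX.exists_mem hw
      obtain ⟨j, _, hj⟩ := Finset.mem_biUnion.1 (hX _ ht).1
      have := hU j w hj
      exact ⟨by omega, hsep v hv⟩
    have := (Finset.sum_eq_sum_iff_of_le fun i _ => hSr i).1 hsum i (Finset.mem_univ i)
    omega
  have := card_le_of_signed_levels (W := W) (M := 2 * k - 1 + m)
    (fun X j s => (j + 1 < 2 * k ∧ A X (j + 1) s) ∨ ∃ i : Fin m, j = 2 * k - 1 + i ∧ B X i s)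
    (by
      rintro X Y j s hXY (⟨hj, q, h1, h2, h3⟩ | ⟨i, hj, hB⟩)
      · exact Or.inl ⟨hj, q, h1, h2, h3.mono hXY⟩
      · refine Or.inr ⟨i, hj, le_trans hB (Finset.card_le_card ?_)⟩
        exact Finset.monotone_filter_right _ fun v _ hv => hXY hv)
    (by
      intro X j s
      simp only [A, B, altIn_map_flipSign, mem_map_flipSign])
    (by
      rintro X j s (⟨hj, _⟩ | ⟨i, hj, _⟩) <;> omega)
    (by
      rintro X hX ⟨⟨v, s⟩, hv⟩
      exact ⟨0, s, Or.inl ⟨by omega, [v], rfl, by simp, hv, trivial⟩⟩)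
    (by
      rintro X j hX (⟨hj, q, hq, hqs, hqX⟩ | ⟨i, hj, hB⟩)
        (⟨hj', q', hq', hqs', hqX'⟩ | ⟨i', hj', hB'⟩)
      · obtain ⟨s, hA⟩ := hqX.exists_longer (fun p hp => (hX p hp).2) hqX' hq hq' hqs hqs'
        by_cases hj2 : j + 2 < 2 * k
        · exact ⟨j + 1, s, by omega, Or.inl ⟨hj2, hA⟩⟩
        · have hj3 : j + 2 = 2 * k := by omega
          obtain ⟨i, hi⟩ := hAB X s hX (hj3 ▸ hA)
          exact ⟨2 * k - 1 + i, s, by omega, Or.inr ⟨i, rfl, hi⟩⟩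
      · omega
      · omega
      · obtain rfl : i = i' := Fin.ext (by omega)
        exfalso
        have hd : Disjoint {v ∈ U i | (v, true) ∈ X} {v ∈ U i | (v, false) ∈ X} :=
          Finset.disjoint_filter.2 fun v _ hv => (hX _ hv).2
        have h1 := Finset.card_le_card (Finset.union_subset
          (Finset.filter_subset (fun v => (v, true) ∈ X) (U i))
          (Finset.filter_subset (fun v => (v, false) ∈ X) (U i)))
        rw [Finset.card_union_of_disjoint hd, hcard] at h1
        simp only [B] at hB hB'
        omega)
  omega

theorem fair_independent_set_in_cycle (n m : ℕ) (hn : 3 ≤ n) (hm : 1 ≤ m)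
    (V : Fin m → Finset (ZMod n))
    (hdisj : ∀ i j, i ≠ j → Disjoint (V i) (V j))
    (hne : ∀ i, (V i).Nonempty)
    (hcover : ∀ v : ZMod n, ∃ i, v ∈ V i) :
    ∃ S : Finset (ZMod n), CycleIndepSet n S ∧
      ∀ i, (V i).card ≤ 2 * (S ∩ V i).card + 2 := by
  have : NeZero n := ⟨by omega⟩
  have hU : ∀ i, ∃ U ⊆ (V i).image ZMod.val, U.card = 2 * (((V i).card - 1) / 2) + 1 := by
    intro i
    apply Finset.exists_subset_card_eq
    rw [Finset.card_image_of_injective _ (ZMod.val_injective n)]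
    have := (hne i).card_pos
    omega
  choose U hUV hUcard using hU
  have hUn : ∀ i, ∀ v ∈ U i, v < n ∧ (v : ZMod n) ∈ V i := by
    intro i v hv
    obtain ⟨x, hx, rfl⟩ := Finset.mem_image.1 (hUV i hv)
    exact ⟨ZMod.val_lt x, by simpa using hx⟩
  obtain ⟨S, hS, hfair⟩ := exists_fair_separated U (fun i => ((V i).card - 1) / 2)
    (fun i j hij => Finset.disjoint_left.2 fun v hi hj =>
      Finset.disjoint_left.1 (hdisj i j hij) (hUn i v hi).2 (hUn j v hj).2)
    (fun i v hv => (hUn i v hv).1) hUcard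
  have hinj : ∀ a b : ℕ, a < n → b < n → (a : ZMod n) = b → a = b := by
    intro a b ha hb hab
    rw [← ZMod.val_cast_of_lt ha, ← ZMod.val_cast_of_lt hb, hab]
  refine ⟨S.image (fun v : ℕ => (v : ZMod n)), ?_, fun i => ?_⟩
  · intro v hv hv'
    obtain ⟨a, ha, rfl⟩ := Finset.mem_image.1 hv
    obtain ⟨b, hb, hab⟩ := Finset.mem_image.1 hv'
    have h1 := (hS a ha).1
    have h2 := (hS b hb).1
    obtain rfl := hinj b (a + 1) (by omega) h1 (by simpa using hab)
    exact (hS a ha).2 hb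
  · have hle : (S ∩ U i).card ≤ (S.image (fun v : ℕ => (v : ZMod n)) ∩ V i).card := by
      refine Finset.card_le_card_of_injOn (fun v : ℕ => (v : ZMod n)) ?_ ?_
      · intro v hv
        have hv := Finset.mem_inter.1 hv
        exact Finset.mem_inter.2 ⟨Finset.mem_image_of_mem _ hv.1, (hUn i v hv.2).2⟩
      · intro a ha b hb hab
        exact hinj a b (hUn i a (Finset.mem_inter.1 ha).2).1
          (hUn i b (Finset.mem_inter.1 hb).2).1 hab
    have := hfair i
    omega
end

section
/- Let x and y be nonzero sign vectors in {+,−,0}^n with x ⪯ y and alt(x) = alt(y). Then the first nonzero value of x equals the first nonzero value of y; that is, if i_x is the least index with x_{i_x} ≠ 0 and i_y is the least index with y_{i_y} ≠ 0, then x_{i_x} = y_{i_y}. -/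
/-- A list of indices is an alternating sequence for the sign vector `x` if it is
strictly increasing, all the corresponding entries of `x` are nonzero, and
consecutive entries differ. -/
def IsAltSeq {n : ℕ} (x : Fin n → SignType) (l : List (Fin n)) : Prop :=
  l.Chain' (· < ·) ∧ (∀ i ∈ l, x i ≠ 0) ∧ l.Chain' (fun a b => x a ≠ x b)

/-- `altLen x` is the maximum length of an alternating subsequence of nonzero
entries of the sign vector `x`. -/
noncomputable def altLen {n : ℕ} (x : Fin n → SignType) : ℕ :=
  sSup {ℓ : ℕ | ∃ l : List (Fin n), IsAltSeq x l ∧ l.length = ℓ}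

theorem IsAltSeq.length_le {n : ℕ} {x : Fin n → SignType} {l : List (Fin n)}
    (h : IsAltSeq x l) : l.length ≤ n := by
  have hp : l.Pairwise (· < ·) := List.isChain_iff_pairwise.mp h.1
  have hd : l.Nodup := hp.imp fun hab => ne_of_lt hab
  simpa using hd.length_le_card

theorem bddAbove_altSeq_length {n : ℕ} (x : Fin n → SignType) :
    BddAbove {ℓ : ℕ | ∃ l : List (Fin n), IsAltSeq x l ∧ l.length = ℓ} :=
  ⟨n, by rintro _ ⟨l, hl, rfl⟩; exact hl.length_le⟩

theorem IsAltSeq.length_le_altLen {n : ℕ} {x : Fin n → SignType} {l : List (Fin n)}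
    (h : IsAltSeq x l) : l.length ≤ altLen x :=
  le_csSup (bddAbove_altSeq_length x) ⟨l, h, rfl⟩

theorem isAltSeq_nil {n : ℕ} (x : Fin n → SignType) : IsAltSeq x [] :=
  ⟨List.isChain_nil, by simp, List.isChain_nil⟩

theorem exists_isAltSeq_length_eq_altLen {n : ℕ} (x : Fin n → SignType) :
    ∃ l : List (Fin n), IsAltSeq x l ∧ l.length = altLen x :=
  Nat.sSup_mem (s := {ℓ : ℕ | ∃ l : List (Fin n), IsAltSeq x l ∧ l.length = ℓ})
    ⟨0, [], isAltSeq_nil x, rfl⟩ (bddAbove_altSeq_length x)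

theorem IsAltSeq.cons {n : ℕ} {x : Fin n → SignType} {l : List (Fin n)} {i : Fin n}
    (h : IsAltSeq x l) (hi : x i ≠ 0) (hl : ∀ a ∈ l.head?, i < a ∧ x i ≠ x a) :
    IsAltSeq x (i :: l) :=
  ⟨List.isChain_cons.mpr ⟨fun a ha => (hl a ha).1, h.1⟩,
    List.forall_mem_cons.mpr ⟨hi, h.2.1⟩,
    List.isChain_cons.mpr ⟨fun a ha => (hl a ha).2, h.2.2⟩⟩

/-- Alternating sequences persist when zero entries are replaced by arbitrary signs. -/
theorem IsAltSeq.of_le {n : ℕ} {x y : Fin n → SignType} {l : List (Fin n)}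
    (h : IsAltSeq x l) (hle : ∀ i, x i = 0 ∨ x i = y i) : IsAltSeq y l := by
  have heq : ∀ i ∈ l, x i = y i := fun i hi => (hle i).resolve_left (h.2.1 i hi)
  refine ⟨h.1, fun i hi => heq i hi ▸ h.2.1 i hi, ?_⟩
  refine List.IsChain.imp_of_mem_imp (fun a b ha hb hab => ?_) h.2.2
  rwa [← heq a ha, ← heq b hb]

theorem first_nonzero_of_eq_alt (n : ℕ) (x y : Fin n → SignType)
    (hx : x ≠ 0) (hy : y ≠ 0)
    (hle : ∀ i, x i = 0 ∨ x i = y i)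
    (halt : altLen x = altLen y)
    (ix iy : Fin n)
    (hix : x ix ≠ 0) (hixmin : ∀ j, j < ix → x j = 0)
    (hiy : y iy ≠ 0) (hiymin : ∀ j, j < iy → y j = 0) :
    x ix = y iy := by
  by_contra hne
  have hxy : ∀ i, x i ≠ 0 → x i = y i := fun i hi => (hle i).resolve_left hi
  have hlt : iy < ix := by
    refine lt_of_le_of_ne (not_lt.mp fun h => hix ((hxy ix hix).trans (hiymin ix h))) ?_
    rintro rfl
    exact hne (hxy iy hix)
  obtain ⟨l, hl, hlen⟩ := exists_isAltSeq_length_eq_altLen x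
  -- A longest alternating sequence starts with the first nonzero sign.
  have hhead : ∀ a ∈ l.head?, x a = x ix := by
    intro a ha
    by_contra hax
    have hxa : x a ≠ 0 := hl.2.1 a (List.mem_of_mem_head? ha)
    have hlonger : IsAltSeq x (ix :: l) := by
      refine hl.cons hix fun b hb => ?_
      obtain rfl : a = b := Option.mem_unique ha hb
      refine ⟨lt_of_le_of_ne (not_lt.mp fun h => hxa (hixmin a h)) ?_, Ne.symm hax⟩
      rintro rfl
      exact hax rfl
    have := hlonger.length_le_altLen
    simp only [List.length_cons] at this
    omega
  have hlonger : IsAltSeq y (iy :: l) := by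
    refine (hl.of_le hle).cons hiy fun a ha => ?_
    have hxa : x a ≠ 0 := hl.2.1 a (List.mem_of_mem_head? ha)
    refine ⟨hlt.trans_le (not_lt.mp fun h => hxa (hixmin a h)), ?_⟩
    rw [← hxy a hxa, hhead a ha]
    exact Ne.symm hne
  have := hlonger.length_le_altLen
  simp only [List.length_cons] at this
  omega
end

section
/- Let n ≥ 1 and let V_1, …, V_n be a partition of the vertex set ZMod (3n) of the cycle C_{3n} into n sets each of size exactly 3. Then there exist two disjoint independent sets S_1 and S_2 of C_{3n} such that |S_1 ∩ V_i| = 1 and |S_2 ∩ V_i| = 1 for every i ∈ {1,…,n}. -/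
/-- A function on `ι → Fin 3` whose sums along the lines in direction `i` vanish has sum zero
in characteristic two. -/
theorem sum_eq_zero_of_line_sums_eq_zero {ι : Type*} [Fintype ι] [DecidableEq ι]
    (F : (ι → Fin 3) → ZMod 2) (i : ι)
    (hF : ∀ d, ∑ x, F (Function.update d i x) = 0) : ∑ d, F d = 0 := by
  let e (c : Fin 3) : ι → Fin 3 := Pi.single i c
  have hshift (c : Fin 3) : ∑ d, F (d + e c) = ∑ d, F d :=
    Equiv.sum_comp (Equiv.addRight (e c)) F
  have hupdate (d : ι → Fin 3) (c : Fin 3) :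
      d + e c = Function.update d i (d i + c) := by
    ext j
    by_cases h : j = i
    · subst h; simp [e]
    · simp [e, h]
  have htriple : ∑ c : Fin 3, ∑ d, F (d + e c) = 0 := by
    rw [Finset.sum_comm]
    refine Finset.sum_eq_zero fun d _ => ?_
    simp_rw [hupdate]
    rw [← hF d]
    exact Equiv.sum_comp (Equiv.addLeft (d i)) fun x => F (Function.update d i x)
  simp_rw [hshift] at htriple
  simpa [show (3 : ZMod 2) = 1 from rfl] using htriple

/-- Modulo two, the product of the row sums of a matrix that depends on independent choices from
triples is odd in total, provided that the matrix is symmetric with unit diagonal, its `(i, j)`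
entry depends only on the choices at `i` and `j`, and the off-diagonal entries sum to zero over
the choices at `i`. Hence some choice makes every row sum odd. -/
theorem exists_choice_row_sums_eq_one {ι : Type*} [Fintype ι] [DecidableEq ι]
    (K : ι → ι → Fin 3 → Fin 3 → ZMod 2)
    (hsymm : ∀ i j a b, i ≠ j → K i j a b = K j i b a)
    (hsum : ∀ i j b, i ≠ j → ∑ a, K i j a b = 0)
    (hdiag : ∀ i a, K i i a a = 1) :
    ∃ d : ι → Fin 3, ∀ i, ∑ j, K i j (d i) (d j) = 1 := by
  let W (φ : ι → ι) : ZMod 2 := ∑ d : ι → Fin 3, ∏ i, K i (φ i) (d i) (d (φ i))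
  have hnonsurj (φ : ι → ι) (hφ : ¬ Function.Surjective φ) : W φ = 0 := by
    obtain ⟨i, hi⟩ : ∃ i, ∀ k, φ k ≠ i := by simpa [Function.Surjective] using hφ
    refine sum_eq_zero_of_line_sums_eq_zero _ i fun d => ?_
    have hprod (x : Fin 3) :
        ∏ k, K k (φ k) (Function.update d i x k) (Function.update d i x (φ k)) =
          K i (φ i) x (d (φ i)) * ∏ k ∈ Finset.univ.erase i, K k (φ k) (d k) (d (φ k)) := by
      rw [← Finset.mul_prod_erase _ _ (Finset.mem_univ i)]
      congr 1
      · simp [hi]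
      · refine Finset.prod_congr rfl fun k hk => ?_
        simp [hi, Finset.ne_of_mem_erase hk]
    simp_rw [hprod]
    rw [← Finset.sum_mul, hsum _ _ _ (hi i).symm, zero_mul]
  have hinv (σ : Equiv.Perm ι) : W ⇑σ⁻¹ = W σ := by
    refine Finset.sum_congr rfl fun d _ => ?_
    rw [← Equiv.prod_comp σ]
    refine Finset.prod_congr rfl fun k _ => ?_
    by_cases h : σ k = k
    · simp [(Equiv.symm_apply_eq σ).mpr h.symm, h]
    · simpa using hsymm _ _ _ _ h
  have hinvolution (σ : Equiv.Perm ι) (hσ : σ⁻¹ = σ) (hσ1 : σ ≠ 1) : W σ = 0 := by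
    obtain ⟨i, hi⟩ : ∃ i, σ i ≠ i := by
      by_contra! h
      exact hσ1 (Equiv.ext h)
    have hσσ (k : ι) : σ (σ k) = k := by
      nth_rw 1 [← hσ]
      exact σ.symm_apply_apply k
    refine sum_eq_zero_of_line_sums_eq_zero _ i fun d => ?_
    have hprod (x : Fin 3) :
        ∏ k, K k (σ k) (Function.update d i x k) (Function.update d i x (σ k)) =
          K i (σ i) x (d (σ i)) *
            ∏ k ∈ (Finset.univ.erase i).erase (σ i), K k (σ k) (d k) (d (σ k)) := by
      rw [← Finset.mul_prod_erase _ _ (Finset.mem_univ i),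
        ← Finset.mul_prod_erase _ _ (show σ i ∈ Finset.univ.erase i by simp [hi]), ← mul_assoc]
      congr 1
      · simp only [Function.update_self, hσσ, Function.update_of_ne hi]
        rw [hsymm _ _ _ _ hi]
        generalize K i (σ i) x (d (σ i)) = z
        revert z
        decide
      · refine Finset.prod_congr rfl fun k hk => ?_
        have hk' : σ k ≠ i := fun h => (Finset.mem_erase.mp hk).1 (by rw [← h, hσσ])
        have hk'' : k ≠ i := by simp_all
        simp [hk', hk'']
    simp_rw [hprod]
    rw [← Finset.sum_mul, hsum _ _ _ hi.symm, zero_mul]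
  have hone : W (1 : Equiv.Perm ι) = 1 := by
    simp [W, hdiag, show (3 : ZMod 2) = 1 from rfl]
  have hperm : ∑ σ : Equiv.Perm ι, W σ = 1 := by
    rw [← Finset.add_sum_erase _ _ (Finset.mem_univ 1), hone, add_eq_left]
    refine Finset.sum_involution (fun σ _ => σ⁻¹) (fun σ _ => ?_) (fun σ hσ h h' => ?_)
      (fun σ hσ => by simpa using hσ) (fun σ _ => inv_inv σ)
    · rw [hinv, CharTwo.add_self_eq_zero]
    · exact h (hinvolution σ h' (Finset.ne_of_mem_erase hσ))
  have htotal : ∑ d : ι → Fin 3, ∏ i, ∑ j, K i j (d i) (d j) = 1 := by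
    simp_rw [Finset.prod_univ_sum, Fintype.piFinset_univ]
    rw [Finset.sum_comm, ← hperm]
    refine (Fintype.sum_of_injective (fun σ : Equiv.Perm ι => (σ : ι → ι))
      DFunLike.coe_injective _ _ (fun φ hφ => hnonsurj φ fun hs => hφ ?_) fun σ => rfl).symm
    exact ⟨Equiv.ofBijective φ (Finite.surjective_iff_bijective.mp hs), rfl⟩
  obtain ⟨d, -, hd⟩ := Finset.exists_ne_zero_of_sum_ne_zero (htotal.trans_ne one_ne_zero)
  exact ⟨d, fun i => Fin.eq_one_of_ne_zero _ (Finset.prod_ne_zero_iff.mp hd i (Finset.mem_univ i))⟩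

theorem ZMod.val_lt_indicator_add_succ {N : ℕ} [NeZero N] (v c : ZMod N) :
    ((if v.val < c.val then 1 else 0) + (if (v + 1).val < c.val then 1 else 0) : ZMod 2) =
      (if c = v + 1 then 1 else 0) + (if v + 1 = 0 then 1 else 0) := by
  have hc := c.val_lt
  have hcv : c = v + 1 ↔ c.val = (v + 1).val := (ZMod.val_injective N).eq_iff.symm
  have h0 : v + 1 = 0 ↔ (v + 1).val = 0 := (ZMod.val_eq_zero _).symm
  have hv := v.val_lt
  have hsucc : (v + 1).val = if v.val + 1 = N then 0 else v.val + 1 := by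
    have : (v + 1).val = (v.val + 1) % N := by
      conv_lhs => rw [← ZMod.natCast_zmod_val v]
      exact_mod_cast ZMod.val_natCast N (v.val + 1)
    rw [this]
    split_ifs with h
    · simp [h]
    · exact Nat.mod_eq_of_lt (by omega)
  simp only [hcv, h0, hsucc]
  have h11 : (1 + 1 : ZMod 2) = 0 := rfl
  split_ifs <;> first | omega | contradiction | simp [h11]

/-- From any partition of the vertices of a cycle into triples, one vertex of each triple can be
removed so that the remaining vertices, coloured alternately around the cycle, have both colours
in every triple. -/
theorem exists_alternating_colouring {n N : ℕ} [NeZero N] (x : Fin n × Fin 3 ≃ ZMod N) :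
    ∃ (d : Fin n → Fin 3) (s : ZMod N → ZMod 2),
      (∀ v, (∀ i, v + 1 ≠ x (i, d i)) → s v ≠ s (v + 1)) ∧
      ∀ i, ∑ a, (if a = d i then 0 else s (x (i, a))) = 1 := by
  let L (u v : ZMod N) : ZMod 2 := if u.val < v.val then 1 else 0
  let q (a b : Fin 3) : ZMod 2 := if b = a then 0 else 1
  have hL (u v : ZMod N) (h : u ≠ v) : L u v = 1 + L v u := by
    have : u.val ≠ v.val := (ZMod.val_injective N).ne h
    have h11 : (1 + 1 : ZMod 2) = 0 := rfl
    simp only [L]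
    split_ifs <;> first | omega | simp [h11]
  have hq (a : Fin 3) : ∑ b, q a b = 0 := by revert a; decide
  have hq' (b : Fin 3) : ∑ a, q a b = 0 := by revert b; decide
  have hx {i j : Fin n} (a b : Fin 3) (h : i ≠ j) : x (i, a) ≠ x (j, b) := by simp [h]
  obtain ⟨d, hd⟩ := exists_choice_row_sums_eq_one
    (fun i j a b => ∑ a', ∑ b', q a a' * (q b b' * L (x (i, a')) (x (j, b'))))
    (fun i j a b hij => by
      simp_rw [hL _ _ (hx _ _ hij), mul_add, Finset.sum_add_distrib, mul_one, ← Finset.mul_sum,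
        hq, mul_zero, Finset.sum_const_zero, zero_add, Finset.mul_sum]
      rw [Finset.sum_comm]
      simp_rw [mul_left_comm])
    (fun i j b hij => by
      rw [Finset.sum_comm]
      refine Finset.sum_eq_zero fun a' _ => ?_
      rw [Finset.sum_comm]
      simp_rw [← Finset.sum_mul, hq', zero_mul, Finset.sum_const_zero])
    (fun i a => by
      have hne (a b : Fin 3) (h : a ≠ b) : x (i, a) ≠ x (i, b) := by simp [h]
      have h00 (u : ZMod N) : L u u = 0 := by simp [L]
      have h01 := hL _ _ (hne 0 1 (by decide))
      have h02 := hL _ _ (hne 0 2 (by decide))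
      have h12 := hL _ _ (hne 1 2 (by decide))
      have h3 (z : ZMod 2) : 1 + z + z = 1 := by revert z; decide
      fin_cases a <;> simp [Fin.sum_univ_three, q, h00, h01, h02, h12, h3])
  let r (c : ZMod N) : ZMod 2 := q (d (x.symm c).1) (x.symm c).2
  have hrsum (g : ZMod N → ZMod 2) :
      ∑ c, r c * g c = ∑ j, ∑ b, q (d j) b * g (x (j, b)) := by
    rw [← Equiv.sum_comp x, Fintype.sum_prod_type]
    simp [r]
  have hr : ∑ c, r c = 0 := by simpa [hq] using hrsum 1
  refine ⟨d, fun u => ∑ c, r c * L u c, fun v hv heq => ?_, fun i => ?_⟩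
  · have hrv : r (v + 1) = 1 := by
      have : (x.symm (v + 1)).2 ≠ d (x.symm (v + 1)).1 := fun h =>
        hv (x.symm (v + 1)).1 (by rw [← h, Prod.mk.eta, Equiv.apply_symm_apply])
      simp [r, q, this]
    have hadd : ∑ c, r c * L v c + ∑ c, r c * L (v + 1) c = 1 := by
      rw [← Finset.sum_add_distrib]
      simp_rw [← mul_add, L, ZMod.val_lt_indicator_add_succ, mul_add, Finset.sum_add_distrib,
        ← Finset.sum_mul, hr]
      simp [hrv]
    simp only at heq
    rw [heq, CharTwo.add_self_eq_zero] at hadd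
    exact zero_ne_one hadd
  · rw [← hd i, Finset.sum_comm]
    refine Finset.sum_congr rfl fun a _ => ?_
    simp_rw [← Finset.mul_sum, ← hrsum]
    simp [q]

theorem card_filter_eq_one_of_sum_eq_one (t : Fin 3) (f : Fin 3 → ZMod 2)
    (h : ∑ a, (if a = t then 0 else f a) = 1) (ε : ZMod 2) :
    (Finset.univ.filter fun a => a ≠ t ∧ f a = ε).card = 1 := by
  revert t f ε
  decide

theorem cycle_plus_triangles_independent_sets (n : ℕ) (hn : 1 ≤ n)
    (V : Fin n → Finset (ZMod (3 * n)))
    (hdisj : ∀ i j, i ≠ j → Disjoint (V i) (V j))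
    (hcover : ∀ v : ZMod (3 * n), ∃ i, v ∈ V i)
    (hsize : ∀ i, (V i).card = 3) :
    ∃ S₁ S₂ : Finset (ZMod (3 * n)),
      Disjoint S₁ S₂ ∧ CycleIndepSet (3 * n) S₁ ∧ CycleIndepSet (3 * n) S₂ ∧
      ∀ i, (S₁ ∩ V i).card = 1 ∧ (S₂ ∩ V i).card = 1 := by
  have : NeZero (3 * n) := ⟨by omega⟩
  let e (i : Fin n) : Fin 3 ≃ V i := ((V i).equivFinOfCardEq (hsize i)).symm
  have hunique {i j : Fin n} {v : ZMod (3 * n)} (hi : v ∈ V i) (hj : v ∈ V j) : i = j := by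
    by_contra h
    exact Finset.disjoint_left.mp (hdisj i j h) hi hj
  let x : Fin n × Fin 3 ≃ ZMod (3 * n) :=
      Equiv.ofBijective (fun p => (e p.1 p.2 : ZMod (3 * n))) <| by
    constructor
    · rintro ⟨i, a⟩ ⟨j, b⟩ h
      obtain rfl : i = j := hunique (e i a).2 (by simpa only [h] using (e j b).2)
      simpa using (e i).injective (Subtype.ext h)
    · intro v
      obtain ⟨i, hi⟩ := hcover v
      exact ⟨(i, (e i).symm ⟨v, hi⟩), by simp⟩
  have hxV (i j : Fin n) (a : Fin 3) : x (i, a) ∈ V j ↔ i = j :=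
    ⟨hunique (e i a).2, fun h => h ▸ (e i a).2⟩
  obtain ⟨d, s, hs, hd⟩ := exists_alternating_colouring x
  let S (ε : ZMod 2) : Finset (ZMod (3 * n)) :=
    Finset.univ.filter fun v => (∀ i, v ≠ x (i, d i)) ∧ s v = ε
  have hindep (ε : ZMod 2) : CycleIndepSet (3 * n) (S ε) := by
    intro v hv hv'
    simp only [S, Finset.mem_filter, Finset.mem_univ, true_and] at hv hv'
    exact hs v hv'.1 (hv.2.trans hv'.2.symm)
  have hcard (ε : ZMod 2) (i : Fin n) : (S ε ∩ V i).card = 1 := by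
    rw [← card_filter_eq_one_of_sum_eq_one (d i) (fun a => s (x (i, a))) (hd i) ε]
    symm
    refine Finset.card_bij (fun a _ => x (i, a)) (fun a ha => ?_)
      (fun a _ b _ h => by simpa using h) fun v hv => ?_
    · simp only [Finset.mem_filter, Finset.mem_univ, true_and] at ha
      simp only [S, Finset.mem_inter, Finset.mem_filter, Finset.mem_univ, true_and, hxV, and_true]
      refine ⟨fun j h => ha.1 ?_, ha.2⟩
      obtain ⟨rfl, h⟩ : i = j ∧ a = d j := by simpa using h
      exact h
    · obtain ⟨⟨j, a⟩, rfl⟩ := x.surjective v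
      simp only [S, Finset.mem_inter, Finset.mem_filter, Finset.mem_univ, true_and, hxV] at hv
      obtain ⟨⟨hne, hε⟩, rfl⟩ := hv
      exact ⟨a, by simpa [hε] using hne j, rfl⟩
  refine ⟨S 0, S 1, ?_, hindep 0, hindep 1, fun i => ⟨hcard 0 i, hcard 1 i⟩⟩
  refine Finset.disjoint_left.mpr fun v h0 h1 => ?_
  simp only [S, Finset.mem_filter] at h0 h1
  exact zero_ne_one (h0.2.2.symm.trans h1.2.2)
end

section
/- (Fleischner–Stiebitz; Erdős's 'cycle plus triangles' conjecture.) Let n ≥ 1 and let V_1, …, V_n be a partition of ZMod (3n) into n sets each of size exactly 3. Then there exists a coloring c : ZMod (3n) → {1,2,3} such that c(v) ≠ c(v+1) for every v ∈ ZMod (3n), and c is injective on each V_i (i.e., the three vertices of each V_i receive three distinct colors). Equivalently, the graph on 3n vertices that is the union of the Hamiltonian cycle C_{3n} and a triangle on each V_i is 3-colorable. -/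
open Finset in
theorem sum_eq_zero_of_forall_sum_update_eq_zero {ι M : Type*} [Fintype ι] [DecidableEq ι]
    [AddCommMonoid M] (G : (ι → Fin 3) → M) (i : ι)
    (h : ∀ P : ι → Fin 3, ∑ p, G (Function.update P i p) = 0) : ∑ P, G P = 0 := by
  rw [← (Equiv.funSplitAt i (Fin 3)).symm.sum_comp, Fintype.sum_prod_type_right]
  refine sum_eq_zero fun g _ => ?_
  rw [← h ((Equiv.funSplitAt i (Fin 3)).symm (0, g))]
  refine sum_congr rfl fun p _ => congrArg G (funext fun j => ?_)
  by_cases hj : j = i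
  · subst hj; simp
  · simp [hj, Function.update_of_ne]

theorem prod_sum_eq_sum_prod {ι κ R : Type*} [Fintype ι] [DecidableEq ι] [Fintype κ]
    [CommSemiring R] (f : ι → κ → R) : ∏ i, ∑ j, f i j = ∑ p : ι → κ, ∏ i, f i (p i) := by
  rw [Finset.prod_univ_sum, Fintype.piFinset_univ]

theorem zmod_two_mul_self (x : ZMod 2) : x * x = x := by
  revert x; decide

/-- The non-permutation terms and the non-involutive permutation terms in the expansion of the
product of the row sums cancel modulo two. -/
theorem sum_prod_rowSum_eq_one {ι : Type*} [Fintype ι] [DecidableEq ι]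
    (y : ι → ι → Fin 3 → Fin 3 → ZMod 2)
    (hsymm : ∀ i j, i ≠ j → ∀ p q, y i j p q = y j i q p)
    (hdiag : ∀ i p, y i i p p = 1)
    (hzero : ∀ i j, i ≠ j → ∀ q, ∑ p, y i j p q = 0) :
    ∑ P : ι → Fin 3, ∏ i, ∑ j, y i j (P i) (P j) = 1 := by
  classical
  simp_rw [prod_sum_eq_sum_prod]
  rw [Finset.sum_comm]
  set W : (ι → ι) → ZMod 2 := fun f => ∑ P : ι → Fin 3, ∏ i, y i (f i) (P i) (P (f i)) with hW
  have hns : ∀ f : ι → ι, ¬ Function.Surjective f → W f = 0 := by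
    intro f hf
    simp only [Function.Surjective, not_forall, not_exists] at hf
    obtain ⟨i, hi⟩ := hf
    refine sum_eq_zero_of_forall_sum_update_eq_zero _ i fun P => ?_
    have : ∀ p, ∏ j, y j (f j) (Function.update P i p j) (Function.update P i p (f j)) =
        y i (f i) p (P (f i)) * ∏ j ∈ Finset.univ.erase i, y j (f j) (P j) (P (f j)) := by
      intro p
      rw [← Finset.mul_prod_erase _ _ (Finset.mem_univ i)]
      congr 1
      · simp [Function.update_of_ne (hi i)]
      · refine Finset.prod_congr rfl fun j hj => ?_
        rw [Function.update_of_ne (Finset.ne_of_mem_erase hj), Function.update_of_ne (hi j)]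
    simp_rw [this]
    rw [← Finset.sum_mul, hzero i (f i) (fun h => hi i h.symm), zero_mul]
  have hinv : ∀ σ : Equiv.Perm ι, σ ≠ 1 → σ⁻¹ = σ → W σ = 0 := by
    intro σ hσ hσ'
    obtain ⟨i, hi⟩ : ∃ i, σ i ≠ i := by
      by_contra! h
      exact hσ (Equiv.ext h)
    have hσσ : ∀ j, σ (σ j) = j := by
      have h : σ * σ = 1 := by
        nth_rw 1 [← hσ']
        exact inv_mul_cancel σ
      exact fun j => Equiv.congr_fun h j
    refine sum_eq_zero_of_forall_sum_update_eq_zero _ i fun P => ?_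
    have : ∀ p, ∏ j, y j (σ j) (Function.update P i p j) (Function.update P i p (σ j)) =
        y i (σ i) p (P (σ i)) *
          ∏ j ∈ (Finset.univ.erase i).erase (σ i), y j (σ j) (P j) (P (σ j)) := by
      intro p
      rw [← Finset.mul_prod_erase _ _ (Finset.mem_univ i),
        ← Finset.mul_prod_erase _ _ (Finset.mem_erase.2 ⟨hi, Finset.mem_univ (σ i)⟩), ← mul_assoc]
      congr 1
      · rw [hσσ, Function.update_self, Function.update_of_ne hi, ← hsymm i (σ i) hi.symm,
          zmod_two_mul_self]
      · refine Finset.prod_congr rfl fun j hj => ?_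
        simp only [Finset.mem_erase, Finset.mem_univ, and_true] at hj
        rw [Function.update_of_ne hj.2, Function.update_of_ne]
        intro h
        exact hj.1 (by rw [← h, hσσ])
    simp_rw [this]
    rw [← Finset.sum_mul, hzero i (σ i) hi.symm, zero_mul]
  have hswap : ∀ σ : Equiv.Perm ι, W ⇑σ⁻¹ = W σ := by
    intro σ
    refine Finset.sum_congr rfl fun P _ => ?_
    rw [← Equiv.prod_comp σ]
    refine Finset.prod_congr rfl fun j _ => ?_
    rw [show σ⁻¹ (σ j) = j from σ.symm_apply_apply j]
    by_cases h : σ j = j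
    · simp [h]
    · exact hsymm _ _ h _ _
  have hperm : ∑ σ : Equiv.Perm ι, W σ = ∑ f, W f := by
    refine Finset.sum_of_injOn (fun σ : Equiv.Perm ι => ⇑σ) ?_ ?_ ?_ ?_
    · exact fun a _ b _ h => Equiv.coe_fn_injective h
    · simp
    · intro f _ hf
      refine hns f fun hs => hf ⟨Equiv.ofBijective f ⟨Finite.injective_iff_surjective.2 hs, hs⟩, ?_⟩
      simp
      rfl
    · simp
  have hone : W ⇑(1 : Equiv.Perm ι) = 1 := by
    simp only [hW, Equiv.Perm.coe_one, id, hdiag, Finset.prod_const_one, Finset.sum_const,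
      Finset.card_univ, Fintype.card_fun, Fintype.card_fin, nsmul_eq_mul, mul_one, Nat.cast_pow]
    rw [show ((3 : ℕ) : ZMod 2) = 1 from by decide, one_pow]
  change ∑ f, W f = 1
  rw [← hperm, ← Finset.add_sum_erase _ _ (Finset.mem_univ 1), hone]
  rw [Finset.sum_involution (fun σ _ => σ⁻¹)]
  · simp
  · intro σ _
    rw [hswap]
    exact CharTwo.add_self_eq_zero _
  · intro σ hσ hne h
    exact hne (hinv σ (Finset.ne_of_mem_erase hσ) h)
  · intro σ hσ
    simpa using hσ
  · simp

/-- The power of `a` whose exponent is the out-degree of a cycle vertex, where the bit `x`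
(resp. `y`) is `1` iff the arc to the next vertex (resp. from the previous one) points forward. -/
def arcPow (x y : ZMod 2) (a : ℤ) : ℤ := (if x = 1 then a else 1) * (if y = 1 then 1 else a)

/-- The sign with which an orientation contributes at an edge. -/
def arcSign (x : ZMod 2) : ℤ := if x = 1 then 1 else -1

/-- The out-degree of a cycle vertex whose next and previous arcs have orientations `x`, `y`. -/
def outDeg (x y : ZMod 2) : ℤ := (if x = 1 then 1 else 0) + (if y = 1 then 0 else 1)

/-- Half the Vandermonde product of the out-degrees in a triangle. -/
def triangleSign (x y : Fin 3 → ZMod 2) : ℤ :=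
  (outDeg (x 1) (y 1) - outDeg (x 0) (y 0)) * (outDeg (x 2) (y 2) - outDeg (x 0) (y 0)) *
    (outDeg (x 2) (y 2) - outDeg (x 1) (y 1)) / 2

theorem forall_pi_fin_three {p : (Fin 3 → ZMod 2) → Prop}
    (h : ∀ a b c : ZMod 2, p ![a, b, c]) (x : Fin 3 → ZMod 2) : p x := by
  have : x = ![x 0, x 1, x 2] := by
    ext k; fin_cases k <;> rfl
  rw [this]
  exact h _ _ _

theorem sum_sign_mul_prod_arcPow (x y : Fin 3 → ZMod 2) :
    ∑ τ : Equiv.Perm (Fin 3), ((Equiv.Perm.sign τ : ℤˣ) : ℤ) *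
      ∏ k, arcPow (x k) (y k) ((τ k).val : ℤ) = 2 * triangleSign x y := by
  have h := Matrix.det_apply' (Matrix.of fun j k : Fin 3 => arcPow (x k) (y k) (j.val : ℤ))
  simp only [Matrix.of_apply, Int.cast_id] at h
  rw [← h, Matrix.det_fin_three]
  revert y
  revert x
  refine forall_pi_fin_three fun a b c => forall_pi_fin_three ?_
  revert a b c
  decide

theorem triangleSign_add_one (x y : Fin 3 → ZMod 2) :
    triangleSign (fun k => x k + 1) (fun k => y k + 1) = -triangleSign x y := by
  revert y
  revert x
  refine forall_pi_fin_three fun a b c => forall_pi_fin_three ?_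
  revert a b c
  decide

theorem arcSign_add_one (x : ZMod 2) : arcSign (x + 1) = -arcSign x := by
  revert x; decide

theorem arcSign_cast (x : ZMod 2) : ((arcSign x : ℤ) : ZMod 2) = 1 := by
  revert x; decide

theorem triangleSign_cast (x y : Fin 3 → ZMod 2) :
    ((triangleSign x y : ℤ) : ZMod 2) =
      ∑ p : Fin 3, if ∀ k, x k + y k = if k = p then 0 else 1 then
        ∑ k, (if k = p then 0 else 1) * x k else 0 := by
  revert y
  revert x
  refine forall_pi_fin_three fun a b c => forall_pi_fin_three ?_
  revert a b c
  decide

theorem prod_sub_succ_eq_sum {N : ℕ} [NeZero N] (a : ZMod N → ℤ) :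
    ∏ v, (a v - a (v + 1)) = ∑ e : ZMod N → ZMod 2,
      (∏ v, arcSign (e v)) * ∏ v, arcPow (e v) (e (v - 1)) (a v) := by
  have h : ∀ v, a v - a (v + 1) = ∑ b : ZMod 2,
      arcSign b * ((if b = 1 then a v else 1) * (if b = 1 then 1 else a (v + 1))) := by
    intro v
    rw [show (Finset.univ : Finset (ZMod 2)) = {0, 1} from rfl]
    simp [arcSign]
    ring
  simp_rw [h, prod_sum_eq_sum_prod, Finset.prod_mul_distrib, arcPow]
  refine Finset.sum_congr rfl fun e _ => ?_
  simp_rw [Finset.prod_mul_distrib]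
  congr 2
  rw [← Equiv.prod_comp (Equiv.addRight (1 : ZMod N))
    (fun v => if e (v - 1) = 1 then (1 : ℤ) else a v)]
  simp

theorem sum_sign_mul_prod_eq {n N : ℕ} [NeZero N] (t : Fin n × Fin 3 ≃ ZMod N) :
    ∑ σ : Fin n → Equiv.Perm (Fin 3), (∏ i, ((Equiv.Perm.sign (σ i) : ℤˣ) : ℤ)) *
      ∏ v, (((σ (t.symm v).1 (t.symm v).2).val : ℤ) -
        ((σ (t.symm (v + 1)).1 (t.symm (v + 1)).2).val : ℤ)) =
    2 ^ n * ∑ e : ZMod N → ZMod 2, (∏ v, arcSign (e v)) *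
      ∏ i, triangleSign (fun k => e (t (i, k))) (fun k => e (t (i, k) - 1)) := by
  have h : ∀ σ : Fin n → Equiv.Perm (Fin 3), _ := fun σ =>
    prod_sub_succ_eq_sum (fun v => ((σ (t.symm v).1 (t.symm v).2).val : ℤ))
  simp_rw [h, Finset.mul_sum]
  rw [Finset.sum_comm]
  refine Finset.sum_congr rfl fun e _ => ?_
  have h2 : ∀ σ : Fin n → Equiv.Perm (Fin 3),
      ∏ v, arcPow (e v) (e (v - 1)) ((σ (t.symm v).1 (t.symm v).2).val : ℤ) =
      ∏ i, ∏ k, arcPow (e (t (i, k))) (e (t (i, k) - 1)) ((σ i k).val : ℤ) := by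
    intro σ
    rw [← t.prod_comp, Fintype.prod_prod_type]
    simp
  simp_rw [h2]
  have h3 := prod_sum_eq_sum_prod (fun (i : Fin n) (τ : Equiv.Perm (Fin 3)) =>
    ((Equiv.Perm.sign τ : ℤˣ) : ℤ) *
      ∏ k, arcPow (e (t (i, k))) (e (t (i, k) - 1)) ((τ k).val : ℤ))
  simp_rw [sum_sign_mul_prod_arcPow, Finset.prod_mul_distrib] at h3
  rw [Finset.prod_const, Finset.card_univ, Fintype.card_fin] at h3
  rw [← mul_assoc, mul_comm (2 ^ n), mul_assoc, h3, Finset.mul_sum]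
  refine Finset.sum_congr rfl fun σ _ => ?_
  ring

/-- Reversing all arcs of the cycle shows that the signed count of orientations is even. -/
theorem sum_arcSign_mul_triangleSign_eq {n : ℕ} [NeZero (3 * n)]
    (t : Fin n × Fin 3 ≃ ZMod (3 * n)) :
    ∑ e : ZMod (3 * n) → ZMod 2, (∏ v, arcSign (e v)) *
      ∏ i, triangleSign (fun k => e (t (i, k))) (fun k => e (t (i, k) - 1)) =
    2 * ∑ e : ZMod (3 * n) → ZMod 2 with e (-1) = 0, (∏ v, arcSign (e v)) *
      ∏ i, triangleSign (fun k => e (t (i, k))) (fun k => e (t (i, k) - 1)) := by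
  rw [← Finset.sum_filter_add_sum_filter_not _ (fun e : ZMod (3 * n) → ZMod 2 => e (-1) = 0),
    two_mul]
  congr 1
  refine Finset.sum_bij' (fun e _ => e + 1) (fun e _ => e + 1) ?_ ?_ ?_ ?_ ?_
  · intro e he
    simp only [Finset.mem_filter, Finset.mem_univ, true_and, Pi.add_apply, Pi.one_apply] at he ⊢
    generalize e (-1) = x at *
    revert x; decide
  · intro e he
    simp only [Finset.mem_filter, Finset.mem_univ, true_and, Pi.add_apply, Pi.one_apply] at he ⊢
    rw [he]; decide
  · intro e _
    rw [add_assoc, CharTwo.add_self_eq_zero, add_zero]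
  · intro e _
    rw [add_assoc, CharTwo.add_self_eq_zero, add_zero]
  · intro e _
    simp only [Pi.add_apply, Pi.one_apply, triangleSign_add_one, arcSign_add_one, Finset.prod_neg,
      Finset.card_univ, Fintype.card_fin, ZMod.card]
    rw [mul_mul_mul_comm, ← pow_add, show 3 * n + n = 2 * (2 * n) by ring, pow_mul]
    simp

/-- A function on the cycle is determined by its successive differences and one value. -/
theorem eq_partialSum_iff {N : ℕ} [NeZero N] (hN : 1 < N) (δ : ZMod N → ZMod 2)
    (hδ : ∑ v, δ v = 0) (e : ZMod N → ZMod 2) :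
    (e (-1) = 0 ∧ ∀ v, e v + e (v - 1) = δ v) ↔
      e = fun v => ∑ z, if z.val ≤ v.val then δ z else 0 := by
  have : Fact (1 < N) := ⟨hN⟩
  have hlast : ∀ z : ZMod N, z.val ≤ (-1 : ZMod N).val := by
    intro z
    have hz := z.val_lt
    obtain ⟨m, rfl⟩ : ∃ m, N = m + 1 := ⟨N - 1, by omega⟩
    rw [ZMod.val_neg_one]
    omega
  have hE : (fun v : ZMod N => ∑ z, if z.val ≤ v.val then δ z else 0) (-1) = 0 ∧
      ∀ v, (fun v : ZMod N => ∑ z, if z.val ≤ v.val then δ z else 0) v +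
        (fun v : ZMod N => ∑ z, if z.val ≤ v.val then δ z else 0) (v - 1) = δ v := by
    constructor
    · simp [hlast, hδ]
    · intro v
      by_cases hv : v = 0
      · subst hv
        simp [hlast, hδ]
      · have hv1 : 1 ≤ v.val := Nat.one_le_iff_ne_zero.2 (by simpa using hv)
        have hs : (v - 1).val = v.val - 1 := by
          rw [ZMod.val_sub (by rwa [ZMod.val_one]), ZMod.val_one]
        simp only [hs]
        rw [← Finset.sum_add_distrib, Finset.sum_eq_single v]
        · rw [if_pos le_rfl, if_neg (by omega), add_zero]
        · intro z _ hz
          have hz' : z.val ≠ v.val := fun h => hz (ZMod.val_injective N h)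
          by_cases hle : z.val ≤ v.val
          · rw [if_pos hle, if_pos (by omega), CharTwo.add_self_eq_zero]
          · rw [if_neg hle, if_neg (by omega), add_zero]
        · simp
  constructor
  · rintro ⟨h0, h⟩
    generalize (fun v : ZMod N => ∑ z, if z.val ≤ v.val then δ z else 0) = E at *
    have key : ∀ k : ℕ, e ((k : ZMod N) - 1) = E ((k : ZMod N) - 1) := by
      intro k
      induction k with
      | zero => simp [h0, hE.1]
      | succ k ih =>
        have h1 := h (k : ZMod N)
        have h2 := hE.2 (k : ZMod N)
        rw [← h2, ih] at h1
        simpa using h1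
    funext v
    simpa using key (v + 1).val
  · rintro rfl
    exact hE

/-- Parity of the number of comparable pairs between two triangles with one vertex removed
from each. -/
def pairParity (f g : Fin 3 → ℕ) (p q : Fin 3) : ZMod 2 :=
  ∑ k, (if k = p then 0 else 1) * ∑ l, if g l ≤ f k then (if l = q then 0 else 1) else 0

theorem sum_indicator_ne (p : Fin 3) : ∑ k : Fin 3, (if k = p then 0 else 1 : ZMod 2) = 0 := by
  revert p; decide

theorem sum_indicator_ne' (k : Fin 3) : ∑ p : Fin 3, (if k = p then 0 else 1 : ZMod 2) = 0 := by
  revert k; decide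

theorem pairParity_comm (f g : Fin 3 → ℕ) (h : ∀ k l, f k ≠ g l) (p q : Fin 3) :
    pairParity f g p q = pairParity g f q p := by
  rw [← sub_eq_zero, CharTwo.sub_eq_add, pairParity, pairParity]
  simp_rw [Finset.mul_sum]
  rw [Finset.sum_comm (f := fun k l => (if k = q then (0 : ZMod 2) else 1) * _)]
  simp_rw [← Finset.sum_add_distrib]
  trans ∑ k : Fin 3, ∑ l : Fin 3, (if k = p then 0 else 1 : ZMod 2) * (if l = q then 0 else 1)
  · refine Finset.sum_congr rfl fun k _ => Finset.sum_congr rfl fun l _ => ?_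
    have := h k l
    by_cases hle : g l ≤ f k
    · rw [if_pos hle, if_neg (by omega : ¬ f k ≤ g l)]; simp
    · rw [if_neg hle, if_pos (by omega : f k ≤ g l)]; ring
  · simp_rw [← Finset.mul_sum, sum_indicator_ne]
    simp

theorem pairParity_self (f : Fin 3 → ℕ) (hf : Function.Injective f) (p : Fin 3) :
    pairParity f f p p = 1 := by
  have h01 : f 0 ≠ f 1 := hf.ne (by decide)
  have h02 : f 0 ≠ f 2 := hf.ne (by decide)
  have h12 : f 1 ≠ f 2 := hf.ne (by decide)
  fin_cases p <;> simp [pairParity, Fin.sum_univ_three] <;> split_ifs <;> first | omega | decide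

theorem sum_pairParity (f g : Fin 3 → ℕ) (q : Fin 3) : ∑ p, pairParity f g p q = 0 := by
  simp_rw [pairParity]
  rw [Finset.sum_comm]
  simp_rw [← Finset.sum_mul, sum_indicator_ne']
  simp

theorem cast_sum_arcSign_mul_triangleSign {n : ℕ} (hn : 1 ≤ n) [NeZero (3 * n)]
    (t : Fin n × Fin 3 ≃ ZMod (3 * n)) :
    ((∑ e : ZMod (3 * n) → ZMod 2 with e (-1) = 0, (∏ v, arcSign (e v)) *
      ∏ i, triangleSign (fun k => e (t (i, k))) (fun k => e (t (i, k) - 1)) : ℤ) : ZMod 2) = 1 := by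
  push_cast
  simp_rw [arcSign_cast, triangleSign_cast, Finset.prod_const_one, one_mul, prod_sum_eq_sum_prod]
  rw [Finset.sum_comm]
  refine Eq.trans ?_ (sum_prod_rowSum_eq_one
    (fun i j => pairParity (fun k => (t (i, k)).val) (fun k => (t (j, k)).val))
    (fun i j hij p q => pairParity_comm _ _ (fun k l h => hij ?_) p q)
    (fun i p => pairParity_self _ (fun k l h => ?_) p)
    (fun i j _ q => sum_pairParity _ _ q))
  · refine Finset.sum_congr rfl fun P _ => ?_
    set δ : ZMod (3 * n) → ZMod 2 := fun v => if (t.symm v).2 = P (t.symm v).1 then 0 else 1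
      with hδdef
    have hδ : ∑ v, δ v = 0 := by
      rw [← t.sum_comp, Fintype.sum_prod_type]
      simp [hδdef, sum_indicator_ne]
    have hiff : ∀ e : ZMod (3 * n) → ZMod 2, (∀ i, ∀ k, e (t (i, k)) + e (t (i, k) - 1) =
        if k = P i then 0 else 1) ↔ ∀ v, e v + e (v - 1) = δ v := by
      intro e
      rw [← t.forall_congr_right, Prod.forall]
      simp [hδdef]
    rw [Finset.sum_filter]
    have hterm : ∀ e : ZMod (3 * n) → ZMod 2, (if e (-1) = 0 then
        ∏ i, (if ∀ k, e (t (i, k)) + e (t (i, k) - 1) = if k = P i then 0 else 1 then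
          ∑ k, (if k = P i then 0 else 1) * e (t (i, k)) else 0) else 0) =
        if e = (fun v => ∑ z, if z.val ≤ v.val then δ z else 0) then
          ∏ i, ∑ k, (if k = P i then 0 else 1) * e (t (i, k)) else 0 := by
      intro e
      simp_rw [← eq_partialSum_iff (by omega) δ hδ e, ← hiff]
      rw [Finset.prod_ite_zero, ← ite_and]
      simp
    rw [Finset.sum_congr rfl fun e _ => hterm e]
    rw [Finset.sum_ite_eq' Finset.univ, if_pos (Finset.mem_univ _)]
    refine Finset.prod_congr rfl fun i _ => ?_
    simp_rw [pairParity]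
    rw [Finset.sum_comm]
    refine Finset.sum_congr rfl fun k _ => ?_
    rw [← Finset.mul_sum, ← t.sum_comp, Fintype.sum_prod_type]
    simp [hδdef]
  · exact (Prod.ext_iff.1 (t.injective (ZMod.val_injective _ h))).1
  · exact (Prod.ext_iff.1 (t.injective (ZMod.val_injective _ h))).2

/-- A cycle of length `3n` with vertices grouped into triples has a proper colouring that is
bijective on each triple. -/
theorem exists_perm_coloring {n : ℕ} (hn : 1 ≤ n) (t : Fin n × Fin 3 ≃ ZMod (3 * n)) :
    ∃ σ : Fin n → Equiv.Perm (Fin 3), ∀ v,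
      σ (t.symm v).1 (t.symm v).2 ≠ σ (t.symm (v + 1)).1 (t.symm (v + 1)).2 := by
  have : NeZero (3 * n) := ⟨by omega⟩
  by_contra! hcon
  have h := sum_sign_mul_prod_eq t
  rw [sum_arcSign_mul_triangleSign_eq, Finset.sum_eq_zero] at h
  · have hc := cast_sum_arcSign_mul_triangleSign hn t
    have h0 := h.symm
    simp only [mul_eq_zero, pow_eq_zero_iff', OfNat.ofNat_ne_zero, false_and, false_or] at h0
    rw [h0] at hc
    simp at hc
  · intro σ _
    obtain ⟨v, hv⟩ := hcon σ
    rw [Finset.prod_eq_zero (Finset.mem_univ v), mul_zero]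
    rw [hv, sub_self]

/-- The Fleischner–Stiebitz theorem ('cycle plus triangles'): the union of the
Hamiltonian cycle `C_{3n}` on `ZMod (3n)` and a triangle on each part of a
partition into `n` sets of size `3` is `3`-colorable. -/
theorem cycle_plus_triangles_three_colorable (n : ℕ) (hn : 1 ≤ n)
    (V : Fin n → Finset (ZMod (3 * n)))
    (hdisj : ∀ i j, i ≠ j → Disjoint (V i) (V j))
    (hcover : ∀ v : ZMod (3 * n), ∃ i, v ∈ V i)
    (hsize : ∀ i, (V i).card = 3) :
    ∃ c : ZMod (3 * n) → Fin 3,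
      (∀ v : ZMod (3 * n), c v ≠ c (v + 1)) ∧
      ∀ i, Set.InjOn c (V i : Set (ZMod (3 * n))) := by
  have hmem : ∀ x : Fin n × Fin 3, (((V x.1).equivFinOfCardEq (hsize x.1)).symm x.2).1 ∈ V x.1 :=
    fun x => (((V x.1).equivFinOfCardEq (hsize x.1)).symm x.2).2
  have huniq : ∀ {v i j}, v ∈ V i → v ∈ V j → i = j := by
    intro v i j hi hj
    by_contra hij
    exact Finset.disjoint_left.1 (hdisj i j hij) hi hj
  let t : Fin n × Fin 3 ≃ ZMod (3 * n) := Equiv.ofBijective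
    (fun x => (((V x.1).equivFinOfCardEq (hsize x.1)).symm x.2).1) <| by
      constructor
      · rintro ⟨i, k⟩ ⟨j, l⟩ h
        have hi := hmem (i, k)
        have hj := hmem (j, l)
        dsimp only at h hi hj
        obtain rfl : i = j := huniq hi (h ▸ hj)
        simpa [Subtype.ext_iff.symm] using h
      · intro v
        obtain ⟨i, hi⟩ := hcover v
        exact ⟨(i, (V i).equivFinOfCardEq (hsize i) ⟨v, hi⟩), by simp⟩
  have ht : ∀ v i, v ∈ V i → (t.symm v).1 = i := by
    intro v i hv
    refine huniq (v := v) ?_ hv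
    have h := hmem (t.symm v)
    rwa [show (((V (t.symm v).1).equivFinOfCardEq (hsize (t.symm v).1)).symm (t.symm v).2).1 = v
      from t.apply_symm_apply v] at h
  obtain ⟨σ, hσ⟩ := exists_perm_coloring hn t
  refine ⟨fun v => σ (t.symm v).1 (t.symm v).2, hσ, fun i v hv w hw h => ?_⟩
  have hv' := ht v i hv
  have hw' := ht w i hw
  simp only [hv', hw'] at h
  exact t.symm.injective (Prod.ext (hv'.trans hw'.symm) ((σ i).injective h))
end
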